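/- Let q₁, q₂ ∈ L¹(0,π) be real-valued and let f₁, f₂ be rational Herglotz–Nevanlinna functions. If the set of eigenvalues of P(q₁,f₁,∞) equals the set of eigenvalues of P(q₂,f₂,∞), and the set of eigenvalues of P(q₁,f₁,0) equals the set of eigenvalues of P(q₂,f₂,0), then q₁(x) = q₂(x) for almost every x ∈ (0,π) and f₁ = f₂. -/

import Mathlib

open MeasureTheory Set

noncomputable section

/-- A rational Herglotz–Nevanlinna function, given by its canonical data:
`f(λ) = a·λ + c + Σ_j γ_j / (β_j − λ)` with `a ≥ 0`, `γ_j > 0` and `β_1 < … < β_n`. -/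
structure RatHN where
  a : ℝ
  c : ℝ
  n : ℕ
  γ : Fin n → ℝ
  β : Fin n → ℝ
  ha : 0 ≤ a
  hγ : ∀ j, 0 < γ j
  hβ : StrictMono β

namespace RatHN

/-- The value `f(λ)` of a rational Herglotz–Nevanlinna function. -/
def eval (f : RatHN) (lam : ℝ) : ℝ :=
  f.a * lam + f.c + ∑ j : Fin f.n, f.γ j / (f.β j - lam)

/-- `lam` is a pole of `f`. -/
def IsPole (f : RatHN) (lam : ℝ) : Prop := ∃ j, f.β j = lam

end RatHN

/-- A (Carathéodory) solution of `−y″ + Q·y = λ·y` on `[0, L]`: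
a pair of continuous functions `y, y'` satisfying the two integral equations. -/
def IsCaraSol (Q : ℝ → ℝ) (L lam : ℝ) (y y' : ℝ → ℝ) : Prop :=
  ContinuousOn y (Icc 0 L) ∧ ContinuousOn y' (Icc 0 L) ∧
  (∀ x ∈ Icc (0:ℝ) L, y x = y 0 + ∫ t in (0:ℝ)..x, y' t) ∧
  (∀ x ∈ Icc (0:ℝ) L, y' x = y' 0 + ∫ t in (0:ℝ)..x, (Q t - lam) * y t)

/-- `lam` is an eigenvalue of the problem `P(q, f, b)`, where `b : Option ℝ`
and `none` stands for the Dirichlet condition (`b = ∞`) at the right endpoint. -/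
def IsEigen (q : ℝ → ℝ) (f : RatHN) (b : Option ℝ) (lam : ℝ) : Prop :=
  ∃ y y' : ℝ → ℝ, IsCaraSol q Real.pi lam y y' ∧
    (∃ x ∈ Icc (0:ℝ) Real.pi, y x ≠ 0) ∧
    (¬ f.IsPole lam → y' 0 = -f.eval lam * y 0) ∧
    (f.IsPole lam → y 0 = 0) ∧
    (∀ bb : ℝ, b = some bb → y' Real.pi = bb * y Real.pi) ∧
    (b = none → y Real.pi = 0)

/-- The set of eigenvalues of the problem `P(q, f, b)`. -/
def eigenvalues (q : ℝ → ℝ) (f : RatHN) (b : Option ℝ) : Set ℝ :=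
  {lam | IsEigen q f b lam}

/-- `Λ` is an enumeration of the set `S`: a strictly increasing sequence whose
range is exactly `S`. -/
def IsEnum (S : Set ℝ) (Λ : ℕ → ℝ) : Prop :=
  StrictMono Λ ∧ Set.range Λ = S

open Filter Topology

section Integration

theorem absolutelyContinuousOnInterval_integral {E : Type*} [NormedAddCommGroup E]
    [NormedSpace ℝ E] {f : ℝ → E} {a b c : ℝ}
    (h : IntervalIntegrable f volume a b) (hc : c ∈ uIcc a b) :
    AbsolutelyContinuousOnInterval (fun x ↦ ∫ v in c..x, f v) a b := by
  have hn := h.norm.absolutelyContinuousOnInterval_intervalIntegral hc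
  unfold AbsolutelyContinuousOnInterval at hn ⊢
  refine squeeze_zero' (Eventually.of_forall fun _ ↦ Finset.sum_nonneg fun i hi ↦ dist_nonneg)
    ?_ hn
  rw [eventually_inf_principal]
  filter_upwards with E hE
  gcongr with i hi
  obtain ⟨h1, h2⟩ := hE.1 i hi
  have key : ∀ x ∈ uIcc a b, ∀ y ∈ uIcc a b, IntervalIntegrable f volume x y :=
    fun x hx y hy ↦ h.mono_set (uIcc_subset_uIcc hx hy)
  rw [dist_comm, dist_eq_norm, intervalIntegral.integral_interval_sub_left (key _ hc _ h2)
    (key _ hc _ h1), dist_comm, dist_eq_norm,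
    intervalIntegral.integral_interval_sub_left (key _ hc _ h2).norm (key _ hc _ h1).norm]
  exact intervalIntegral.norm_integral_le_abs_integral_norm

theorem mul_eq_add_integral {f g F G : ℝ → ℂ} {L : ℝ}
    (hf : IntervalIntegrable f volume 0 L) (hg : IntervalIntegrable g volume 0 L)
    (hF : ∀ t ∈ Icc 0 L, F t = F 0 + ∫ u in (0:ℝ)..t, f u)
    (hG : ∀ t ∈ Icc 0 L, G t = G 0 + ∫ u in (0:ℝ)..t, g u) {t : ℝ} (ht : t ∈ Icc 0 L) :
    F t * G t = F 0 * G 0 + ∫ u in (0:ℝ)..t, (f u * G u + F u * g u) := by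
  have hL : (0:ℝ) ≤ L := ht.1.trans ht.2
  have h0 : (0:ℝ) ∈ uIcc 0 L := left_mem_uIcc
  have hac : ∀ {f : ℝ → ℂ} (c : ℂ), IntervalIntegrable f volume 0 L →
      AbsolutelyContinuousOnInterval (fun t ↦ c + ∫ u in (0:ℝ)..t, f u) 0 L := by
    intro f c hf
    refine AbsolutelyContinuousOnInterval.fun_add ?_ (absolutelyContinuousOnInterval_integral hf h0)
    exact (LipschitzOnWith.of_dist_le_mul (K := 0) (by simp)).absolutelyContinuousOnInterval
  set F' : ℝ → ℂ := fun t ↦ F 0 + ∫ u in (0:ℝ)..t, f u with hF'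
  set G' : ℝ → ℂ := fun t ↦ G 0 + ∫ u in (0:ℝ)..t, g u with hG'
  have hcF : ContinuousOn F' (uIcc 0 L) := (hac (F 0) hf).continuousOn
  have hcG : ContinuousOn G' (uIcc 0 L) := (hac (G 0) hg).continuousOn
  have hint : IntervalIntegrable (fun u ↦ f u * G' u + F' u * g u) volume 0 L :=
    (hf.mul_continuousOn hcG).add (hg.continuousOn_mul hcF)
  have hcong : ∫ u in (0:ℝ)..t, (f u * G u + F u * g u)
      = ∫ u in (0:ℝ)..t, (f u * G' u + F' u * g u) := by
    apply intervalIntegral.integral_congr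
    intro u hu
    rw [uIcc_of_le ht.1] at hu
    have hu' : u ∈ Icc 0 L := ⟨hu.1, hu.2.trans ht.2⟩
    simp only [hF u hu', hG u hu', hF', hG']
  obtain ⟨C, hC⟩ := AbsolutelyContinuousOnInterval.const_of_ae_hasDerivAt_zero
    (f := fun t ↦ F' t * G' t - ∫ u in (0:ℝ)..t, (f u * G' u + F' u * g u)) (a := 0) (b := L)
    (by
      have h1 := (hac (F 0) hf).fun_smul (hac (G 0) hg)
      exact h1.fun_sub (absolutelyContinuousOnInterval_integral hint h0))
    (by
      filter_upwards [hf.ae_hasDerivAt_integral, hg.ae_hasDerivAt_integral,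
        hint.ae_hasDerivAt_integral] with x h1 h2 h3 hx
      have e1 := ((h1 hx 0 h0).const_add (F 0)).mul ((h2 hx 0 h0).const_add (G 0))
      convert! e1.sub (h3 hx 0 h0) using 1
      simp [hF', hG'])
  have ht' : t ∈ uIcc 0 L := by rwa [uIcc_of_le hL]
  have e := (hC t ht').trans (hC 0 h0).symm
  simp only [intervalIntegral.integral_same, sub_zero] at e
  rw [hcong, hF t ht, hG t ht]
  have e0 : F' 0 = F 0 := by simp [hF']
  have e1 : G' 0 = G 0 := by simp [hG']
  rw [e0, e1] at e
  rw [← e]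
  simp only [hF', hG']; ring

end Integration

section BanachAlgebra

variable {R : Type*} [NormedRing R] [NormedAlgebra ℂ R] [CompleteSpace R]

theorem isUnit_one_sub_of_conj (V Q : R) {D D' : R} {lam : ℂ} {m K : ℝ} (hm0 : 0 ≤ m)
    (hKm : m + ‖lam‖ + 1 ≤ K) (hDD' : D * D' = 1) (hD'D : D' * D = 1)
    (hV1 : ‖D * V * D'‖ ≤ K⁻¹) (hQ1 : ‖D * Q * D'‖ ≤ m) :
    IsUnit (1 - (V * Q - lam • (V * V))) := by
  have hK1 : 1 ≤ K := by have := norm_nonneg lam; linarith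
  have hK : 0 < K := by linarith
  set B := (D * V * D') * (D * Q * D') - lam • ((D * V * D') * (D * V * D')) with hB
  have hBn : ‖B‖ < 1 := by
    have h1 : ‖(D * V * D') * (D * Q * D')‖ ≤ K⁻¹ * m :=
      (norm_mul_le _ _).trans (by gcongr)
    have h2 : ‖lam • ((D * V * D') * (D * V * D'))‖ ≤ ‖lam‖ * (K⁻¹ * K⁻¹) := by
      rw [norm_smul]
      gcongr
      exact (norm_mul_le _ _).trans (by gcongr)
    have h3 : K⁻¹ ≤ 1 := inv_le_one_of_one_le₀ hK1
    have h4 : ‖lam‖ * (K⁻¹ * K⁻¹) ≤ ‖lam‖ * K⁻¹ := by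
      gcongr
      exact mul_le_of_le_one_left (by positivity) h3
    calc ‖B‖ ≤ K⁻¹ * m + ‖lam‖ * K⁻¹ := (norm_sub_le _ _).trans (by linarith)
      _ = (m + ‖lam‖) / K := by ring
      _ < 1 := by rw [div_lt_one hK]; linarith
  have hu : IsUnit (1 - B) := isUnit_one_sub_of_norm_lt_one hBn
  have hB' : B = D * (V * Q - lam • (V * V)) * D' := by
    have e : ∀ X Y : R,
        (D * X * D') * (D * Y * D') = D * (X * Y) * D' := by
      intro X Y
      calc (D * X * D') * (D * Y * D') = D * X * (D' * D) * Y * D' := by simp only [mul_assoc]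
        _ = D * (X * Y) * D' := by rw [hD'D]; simp only [mul_assoc, one_mul]
    rw [hB, e, e, mul_sub, sub_mul, mul_smul_comm, smul_mul_assoc]
  have hfin : 1 - (V * Q - lam • (V * V)) = D' * (1 - B) * D := by
    rw [hB', mul_sub, mul_one, sub_mul, hD'D]
    congr 1
    calc V * Q - lam • (V * V) = (D' * D) * (V * Q - lam • (V * V)) * (D' * D) := by
          rw [hD'D, one_mul, mul_one]
      _ = _ := by simp only [mul_assoc]
  rw [hfin]
  have hD'u : IsUnit D' := ⟨⟨D', D, hD'D, hDD'⟩, rfl⟩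
  have hDu : IsUnit D := ⟨⟨D, D', hDD', hD'D⟩, rfl⟩
  exact (hD'u.mul hu).mul hDu

theorem differentiable_inverse_one_sub (V Q : R)
    (h : ∀ lam : ℂ, IsUnit (1 - (V * Q - lam • (V * V)))) :
    Differentiable ℂ fun lam : ℂ ↦ Ring.inverse (1 - (V * Q - lam • (V * V))) := by
  intro lam
  have h1 : DifferentiableAt ℂ (fun lam : ℂ ↦ 1 - (V * Q - lam • (V * V))) lam := by fun_prop
  exact (differentiableAt_inverse (𝕜 := ℂ) (h lam)).comp lam h1

end BanachAlgebra

section Volterra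

variable {L : ℝ}

theorem intervalIntegrable_mul_IccExtend (hL : 0 ≤ L) {w : ℝ → ℂ}
    (hw : IntervalIntegrable w volume 0 L) (y : C(Icc (0:ℝ) L, ℂ)) :
    IntervalIntegrable (fun u ↦ w u * IccExtend hL y u) volume 0 L :=
  hw.mul_continuousOn (y.continuous.Icc_extend' (h := hL)).continuousOn

theorem norm_IccExtend_le (hL : 0 ≤ L) (y : C(Icc (0:ℝ) L, ℂ)) (u : ℝ) :
    ‖IccExtend hL y u‖ ≤ ‖y‖ := y.norm_coe_le_norm _

theorem integral_norm_le_of_mem {w : ℝ → ℂ} (hw : IntervalIntegrable w volume 0 L) {t : ℝ}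
    (ht : t ∈ Icc 0 L) : ∫ u in (0:ℝ)..t, ‖w u‖ ≤ ∫ u in (0:ℝ)..L, ‖w u‖ :=
  intervalIntegral.integral_mono_interval le_rfl ht.1 ht.2
    (Eventually.of_forall fun _ ↦ norm_nonneg _) hw.norm

theorem continuous_integral_mul_IccExtend (hL : 0 ≤ L) {w : ℝ → ℂ}
    (hw : IntervalIntegrable w volume 0 L) (y : C(Icc (0:ℝ) L, ℂ)) :
    Continuous fun t : Icc (0:ℝ) L ↦ ∫ u in (0:ℝ)..t, w u * IccExtend hL y u := by
  have h := (absolutelyContinuousOnInterval_integral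
    (intervalIntegrable_mul_IccExtend hL hw y) left_mem_uIcc).continuousOn
  rw [uIcc_of_le hL] at h
  exact continuousOn_iff_continuous_domRestrict.mp h

/-- The Volterra operator `y ↦ ∫₀ᵗ w y` on `C([0, L], ℂ)`. -/
def volterra (hL : 0 ≤ L) (w : ℝ → ℂ) (hw : IntervalIntegrable w volume 0 L) :
    C(Icc (0:ℝ) L, ℂ) →L[ℂ] C(Icc (0:ℝ) L, ℂ) :=
  LinearMap.mkContinuous
    { toFun := fun y ↦ ⟨fun t ↦ ∫ u in (0:ℝ)..t, w u * IccExtend hL y u,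
        continuous_integral_mul_IccExtend hL hw y⟩
      map_add' := fun x y ↦ by
        ext t
        have hm : uIcc 0 (t:ℝ) ⊆ uIcc 0 L := by
          rw [uIcc_of_le hL, uIcc_of_le t.2.1]; exact Icc_subset_Icc le_rfl t.2.2
        simp only [ContinuousMap.add_apply]
        change _ = (∫ u in (0:ℝ)..t, _) + ∫ u in (0:ℝ)..t, _
        rw [← intervalIntegral.integral_add
          ((intervalIntegrable_mul_IccExtend hL hw x).mono_set hm)
          ((intervalIntegrable_mul_IccExtend hL hw y).mono_set hm)]
        simp [IccExtend, mul_add]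
      map_smul' := fun c y ↦ by
        ext t
        simp only [ContinuousMap.smul_apply, RingHom.id_apply, smul_eq_mul]
        change _ = c * ∫ u in (0:ℝ)..t, _
        rw [← intervalIntegral.integral_const_mul]
        simp [IccExtend, mul_left_comm] }
    (∫ u in (0:ℝ)..L, ‖w u‖) (fun y ↦ by
      rw [ContinuousMap.norm_le _ (mul_nonneg
        (intervalIntegral.integral_nonneg hL fun _ _ ↦ norm_nonneg _) (norm_nonneg _))]
      intro t
      simp only [LinearMap.coe_mk, AddHom.coe_mk]
      refine (intervalIntegral.norm_integral_le_of_norm_le (g := fun u ↦ ‖w u‖ * ‖y‖) t.2.1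
        (Eventually.of_forall fun u _ ↦ ?_) ?_).trans ?_
      · rw [norm_mul]
        gcongr
        exact norm_IccExtend_le hL y u
      · refine (hw.norm.mono_set ?_).mul_const _
        rw [uIcc_of_le hL, uIcc_of_le t.2.1]; exact Icc_subset_Icc le_rfl t.2.2
      · rw [intervalIntegral.integral_mul_const]
        gcongr
        exact integral_norm_le_of_mem hw t.2)

theorem volterra_apply (hL : 0 ≤ L) (w : ℝ → ℂ) (hw : IntervalIntegrable w volume 0 L)
    (y : C(Icc (0:ℝ) L, ℂ)) (t : Icc (0:ℝ) L) :
    volterra hL w hw y t = ∫ u in (0:ℝ)..t, w u * IccExtend hL y u := rfl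

/-- The exponential weight `exp (K t)` as a continuous function on `[0, L]`. -/
def expWeight (L K : ℝ) : C(Icc (0:ℝ) L, ℂ) :=
  ⟨fun t ↦ ((Real.exp (K * t) : ℝ) : ℂ), by fun_prop⟩

theorem expWeight_mul (L K : ℝ) : expWeight L K * expWeight L (-K) = 1 := by
  ext t
  simp [expWeight, ← Complex.exp_add]

/-- Multiplication by the exponential weight. -/
def mulWeight (L K : ℝ) : C(Icc (0:ℝ) L, ℂ) →L[ℂ] C(Icc (0:ℝ) L, ℂ) :=
  ContinuousLinearMap.mul ℂ _ (expWeight L K)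

theorem mulWeight_mul (L K : ℝ) : mulWeight L K * mulWeight L (-K) = 1 := by
  ext1 y
  simp [mulWeight, ← mul_assoc, expWeight_mul]

theorem mulWeight_mul' (L K : ℝ) : mulWeight L (-K) * mulWeight L K = 1 := by
  simpa using mulWeight_mul L (-K)

theorem norm_conj_volterra_apply_le (hL : 0 ≤ L) (w : ℝ → ℂ)
    (hw : IntervalIntegrable w volume 0 L)
    (K : ℝ) (y : C(Icc (0:ℝ) L, ℂ)) (t : Icc (0:ℝ) L) :
    ‖(mulWeight L (-K) * volterra hL w hw * mulWeight L K) y t‖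
      ≤ (∫ u in (0:ℝ)..t, Real.exp (-(K * (t - u))) * ‖w u‖) * ‖y‖ := by
  have e : (mulWeight L (-K) * volterra hL w hw * mulWeight L K) y t
      = (Real.exp (-K * t) : ℂ) * ∫ u in (0:ℝ)..t, w u * IccExtend hL (expWeight L K * y) u := rfl
  rw [e, ← intervalIntegral.integral_const_mul, ← intervalIntegral.integral_mul_const]
  have hsub : uIcc 0 (t:ℝ) ⊆ uIcc 0 L := by
    rw [uIcc_of_le hL, uIcc_of_le t.2.1]; exact Icc_subset_Icc le_rfl t.2.2
  refine intervalIntegral.norm_integral_le_of_norm_le t.2.1 (Eventually.of_forall fun u hu ↦ ?_) ?_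
  · have hu' : u ∈ Icc 0 L := ⟨hu.1.le, hu.2.trans t.2.2⟩
    have e2 : IccExtend hL (expWeight L K * y) u
        = (Real.exp (K * u) : ℂ) * IccExtend hL y u := by
      simp [IccExtend, expWeight, projIcc_of_mem hL hu']
    rw [e2]
    have : Real.exp (-(K * (t - u))) = Real.exp (-K * t) * Real.exp (K * u) := by
      rw [← Real.exp_add]; ring_nf
    rw [this, norm_mul, norm_mul, norm_mul, Complex.norm_real, Complex.norm_real, Real.norm_eq_abs,
      Real.norm_eq_abs, Real.abs_exp, Real.abs_exp]
    have := norm_IccExtend_le hL y u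
    have h3 : 0 ≤ Real.exp (-K * t) * Real.exp (K * u) * ‖w u‖ := by positivity
    nlinarith [mul_le_mul_of_nonneg_left this h3]
  · exact ((hw.norm.mono_set hsub).continuousOn_mul (by fun_prop)).mul_const _

theorem norm_conj_volterra_le (hL : 0 ≤ L) (w : ℝ → ℂ) (hw : IntervalIntegrable w volume 0 L)
    {K : ℝ} (hK : 0 ≤ K) :
    ‖mulWeight L (-K) * volterra hL w hw * mulWeight L K‖ ≤ ∫ u in (0:ℝ)..L, ‖w u‖ := by
  have h0 : 0 ≤ ∫ u in (0:ℝ)..L, ‖w u‖ :=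
    intervalIntegral.integral_nonneg hL fun _ _ ↦ norm_nonneg _
  refine ContinuousLinearMap.opNorm_le_bound _ h0 fun y ↦ ?_
  rw [ContinuousMap.norm_le _ (mul_nonneg h0 (norm_nonneg _))]
  intro t
  refine (norm_conj_volterra_apply_le hL w hw K y t).trans ?_
  gcongr
  refine le_trans ?_ (integral_norm_le_of_mem hw t.2)
  have hsub : uIcc 0 (t:ℝ) ⊆ uIcc 0 L := by
    rw [uIcc_of_le hL, uIcc_of_le t.2.1]; exact Icc_subset_Icc le_rfl t.2.2
  refine intervalIntegral.integral_mono_on t.2.1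
    ((hw.norm.mono_set hsub).continuousOn_mul (by fun_prop)) (hw.norm.mono_set hsub) fun u hu ↦ ?_
  refine mul_le_of_le_one_left (norm_nonneg _) (Real.exp_le_one_iff.mpr ?_)
  have := mul_nonneg hK (sub_nonneg.mpr hu.2)
  linarith

theorem norm_conj_volterra_one_le (hL : 0 ≤ L) {K : ℝ} (hK : 0 < K) :
    ‖mulWeight L (-K) * volterra hL (fun _ ↦ 1) intervalIntegrable_const * mulWeight L K‖
      ≤ K⁻¹ := by
  refine ContinuousLinearMap.opNorm_le_bound _ (by positivity) fun y ↦ ?_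
  rw [ContinuousMap.norm_le _ (by positivity)]
  intro t
  refine (norm_conj_volterra_apply_le hL _ _ K y t).trans ?_
  gcongr
  have : ∫ u in (0:ℝ)..t, Real.exp (-(K * (t - u))) * ‖(1:ℂ)‖
      = K⁻¹ - K⁻¹ * Real.exp (-(K * t)) := by
    rw [intervalIntegral.integral_eq_sub_of_hasDerivAt
      (f := fun u ↦ K⁻¹ * Real.exp (-(K * ((t:ℝ) - u))))]
    · simp
    · intro u _
      have h1 : HasDerivAt (fun u ↦ -(K * ((t:ℝ) - u))) K u := by
        have := (((hasDerivAt_id u).const_sub (t:ℝ)).const_mul K).neg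
        simpa using! this
      convert! h1.exp.const_mul K⁻¹ using 1
      field_simp
      simp
    · apply Continuous.intervalIntegrable
      fun_prop
  rw [this]
  have : 0 ≤ K⁻¹ * Real.exp (-(K * t)) := by positivity
  linarith

theorem isUnit_one_sub_volterra (hL : 0 ≤ L) (w : ℝ → ℂ) (hw : IntervalIntegrable w volume 0 L)
    (lam : ℂ) :
    IsUnit (1 - (volterra hL (fun _ ↦ 1) intervalIntegrable_const * volterra hL w hw
      - lam • (volterra hL (fun _ ↦ 1) intervalIntegrable_const *
        volterra hL (fun _ ↦ 1) intervalIntegrable_const))) := by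
  have hm0 : 0 ≤ ∫ u in (0:ℝ)..L, ‖w u‖ :=
    intervalIntegral.integral_nonneg hL fun _ _ ↦ norm_nonneg _
  have hK : 0 < (∫ u in (0:ℝ)..L, ‖w u‖) + ‖lam‖ + 1 := by have := norm_nonneg lam; linarith
  exact isUnit_one_sub_of_conj (R := C(Icc (0:ℝ) L, ℂ) →L[ℂ] C(Icc (0:ℝ) L, ℂ)) _ _ hm0 le_rfl
    (mulWeight_mul' L _) (mulWeight_mul L _) (norm_conj_volterra_one_le hL hK)
    (norm_conj_volterra_le hL w hw hK.le)

end Volterra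

/-- A complex Carathéodory solution of `-y'' + q y = lam y` on `[0, L]`, `v` being `y'`. -/
structure IsSol (q : ℝ → ℝ) (L : ℝ) (lam : ℂ) (y v : ℝ → ℂ) : Prop where
  cont : ContinuousOn y (Icc 0 L)
  cont_deriv : ContinuousOn v (Icc 0 L)
  eq_integral : ∀ t ∈ Icc 0 L, y t = y 0 + ∫ u in (0:ℝ)..t, v u
  deriv_eq_integral : ∀ t ∈ Icc 0 L, v t = v 0 + ∫ u in (0:ℝ)..t, ((q u : ℂ) - lam) * y u

theorem exists_isSol {q : ℝ → ℝ} {L : ℝ} (hL : 0 ≤ L) (hq : IntervalIntegrable q volume 0 L)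
    (a b : ℂ) : ∃ y v : ℂ → ℝ → ℂ, (∀ lam, IsSol q L lam (y lam) (v lam)) ∧
      (∀ lam, y lam 0 = a) ∧ (∀ lam, v lam 0 = b) ∧
      (∀ t, Differentiable ℂ fun lam ↦ y lam t) ∧ (∀ t, Differentiable ℂ fun lam ↦ v lam t) := by
  have hw : IntervalIntegrable (fun t ↦ (q t : ℂ)) volume 0 L :=
    ⟨hq.1.ofReal, hq.2.ofReal⟩
  set V := volterra hL (fun _ ↦ (1:ℂ)) intervalIntegrable_const with hV
  set Q := volterra hL (fun t ↦ (q t : ℂ)) hw with hQ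
  set y0 : C(Icc (0:ℝ) L, ℂ) := ⟨fun t ↦ a + b * (t:ℝ), by fun_prop⟩ with hy0
  set Y : ℂ → C(Icc (0:ℝ) L, ℂ) := fun lam ↦
    Ring.inverse (1 - (V * Q - lam • (V * V))) y0 with hY
  have hYd : Differentiable ℂ Y := by
    intro lam
    exact (differentiable_inverse_one_sub (R := C(Icc (0:ℝ) L, ℂ) →L[ℂ] C(Icc (0:ℝ) L, ℂ)) V Q
      (fun lam ↦ isUnit_one_sub_volterra hL _ hw lam) lam).clm_apply (differentiableAt_const y0)
  have hYeq : ∀ lam, Y lam = y0 + V (Q (Y lam)) - lam • V (V (Y lam)) := by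
    intro lam
    have h := Ring.mul_inverse_cancel _ (isUnit_one_sub_volterra hL _ hw lam)
    have h' := congrArg (fun T ↦ T y0) h
    change Y lam - (V (Q (Y lam)) - lam • V (V (Y lam))) = y0 at h'
    rw [← h']; abel
  set Z : ℂ → C(Icc (0:ℝ) L, ℂ) := fun lam ↦
    ContinuousMap.const _ b + (Q (Y lam) - lam • V (Y lam)) with hZ
  have hZd : Differentiable ℂ Z := by
    have e1 : Differentiable ℂ (fun lam ↦ Q (Y lam)) := Q.differentiable.comp hYd
    have e2 : Differentiable ℂ (fun lam ↦ V (Y lam)) := V.differentiable.comp hYd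
    exact (differentiable_const _).add (e1.sub (differentiable_id.smul e2))
  have hev : ∀ (G : ℂ → C(Icc (0:ℝ) L, ℂ)) (_ : Differentiable ℂ G) (t : ℝ),
      Differentiable ℂ fun lam ↦ IccExtend hL (G lam) t := by
    intro G hG t
    exact (ContinuousMap.evalCLM ℂ (projIcc 0 L hL t)).differentiable.comp hG
  have hYt : ∀ lam, ∀ t ∈ Icc 0 L, IccExtend hL (Y lam) t
      = a + ∫ u in (0:ℝ)..t, IccExtend hL (Z lam) u := by
    intro lam t ht
    have h1 : V (Z lam) ⟨t, ht⟩ = b * t + V (Q (Y lam)) ⟨t, ht⟩ - lam * V (V (Y lam)) ⟨t, ht⟩ := by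
      simp only [hZ, map_add, map_sub, map_smul, ContinuousMap.add_apply, ContinuousMap.sub_apply,
        ContinuousMap.smul_apply, smul_eq_mul]
      rw [show V (ContinuousMap.const _ b) ⟨t, ht⟩ = b * t by
        simp [hV, volterra_apply, IccExtend, mul_comm]]
      ring
    have h2 : V (Z lam) ⟨t, ht⟩ = ∫ u in (0:ℝ)..t, IccExtend hL (Z lam) u := by
      simp [hV, volterra_apply]
    rw [← h2, h1, IccExtend_of_mem hL _ ht]
    conv_lhs => rw [hYeq lam]
    simp [hy0]
    ring
  have hZt : ∀ lam, ∀ t ∈ Icc 0 L, IccExtend hL (Z lam) t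
      = b + ∫ u in (0:ℝ)..t, ((q u : ℂ) - lam) * IccExtend hL (Y lam) u := by
    intro lam t ht
    have hsub : uIcc 0 t ⊆ uIcc 0 L := by
      rw [uIcc_of_le hL, uIcc_of_le ht.1]; exact Icc_subset_Icc le_rfl ht.2
    rw [IccExtend_of_mem hL _ ht]
    simp only [hZ, ContinuousMap.add_apply, ContinuousMap.sub_apply, ContinuousMap.const_apply,
        ContinuousMap.smul_apply, smul_eq_mul, hV, hQ, volterra_apply]
    rw [← intervalIntegral.integral_const_mul, ← intervalIntegral.integral_sub
      ((intervalIntegrable_mul_IccExtend hL hw _).mono_set hsub)]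
    · congr 1
      apply intervalIntegral.integral_congr
      intro u _
      simp only
      ring
    · exact (((intervalIntegrable_mul_IccExtend hL intervalIntegrable_const _).mono_set
        hsub).const_mul _)
  have h0 : (0:ℝ) ∈ Icc 0 L := ⟨le_rfl, hL⟩
  have hY0 : ∀ lam, IccExtend hL (Y lam) 0 = a := fun lam ↦ by rw [hYt lam 0 h0]; simp
  have hZ0 : ∀ lam, IccExtend hL (Z lam) 0 = b := fun lam ↦ by rw [hZt lam 0 h0]; simp
  refine ⟨fun lam ↦ IccExtend hL (Y lam), fun lam ↦ IccExtend hL (Z lam),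
    fun lam ↦ ⟨?_, ?_, ?_, ?_⟩,
    hY0, hZ0, hev Y hYd, hev Z hZd⟩
  · exact ((Y lam).continuous.Icc_extend' (h := hL)).continuousOn
  · exact ((Z lam).continuous.Icc_extend' (h := hL)).continuousOn
  · exact fun t ht ↦ (hYt lam t ht).trans (congrArg (· + _) (hY0 lam).symm)
  · exact fun t ht ↦ (hZt lam t ht).trans (congrArg (· + _) (hZ0 lam).symm)

section Solutions

open scoped ComplexConjugate

namespace IsSol

variable {q : ℝ → ℝ} {L : ℝ} {lam mu : ℂ} {y v z w : ℝ → ℂ}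

theorem intervalIntegrable_deriv (h : IsSol q L lam y v) (hL : 0 ≤ L) :
    IntervalIntegrable v volume 0 L := by
  apply ContinuousOn.intervalIntegrable
  rw [uIcc_of_le hL]
  exact h.cont_deriv

theorem intervalIntegrable_coeff (h : IsSol q L lam y v) (hL : 0 ≤ L)
    (hq : IntervalIntegrable q volume 0 L) :
    IntervalIntegrable (fun u ↦ ((q u : ℂ) - lam) * y u) volume 0 L := by
  have hw : IntervalIntegrable (fun t ↦ (q t : ℂ) - lam) volume 0 L :=
    IntervalIntegrable.sub ⟨hq.1.ofReal, hq.2.ofReal⟩ intervalIntegrable_const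
  apply hw.mul_continuousOn
  rw [uIcc_of_le hL]
  exact h.cont

theorem lagrange (h : IsSol q L lam y v) (h' : IsSol q L mu z w)
    (hq : IntervalIntegrable q volume 0 L) {t : ℝ} (ht : t ∈ Icc 0 L) :
    y t * w t - v t * z t
      = y 0 * w 0 - v 0 * z 0 + (lam - mu) * ∫ u in (0:ℝ)..t, y u * z u := by
  have hL : 0 ≤ L := ht.1.trans ht.2
  have hsub : uIcc 0 t ⊆ uIcc 0 L := by
    rw [uIcc_of_le hL, uIcc_of_le ht.1]; exact Icc_subset_Icc le_rfl ht.2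
  have i1 := h.intervalIntegrable_deriv hL
  have i2 := h'.intervalIntegrable_deriv hL
  have i3 := h.intervalIntegrable_coeff hL hq
  have i4 := h'.intervalIntegrable_coeff hL hq
  have e1 := mul_eq_add_integral i1 i4 h.eq_integral h'.deriv_eq_integral ht
  have e2 := mul_eq_add_integral i3 i2 h.deriv_eq_integral h'.eq_integral ht
  have c1 : ContinuousOn y (uIcc 0 L) := by rw [uIcc_of_le hL]; exact h.cont
  have c2 : ContinuousOn z (uIcc 0 L) := by rw [uIcc_of_le hL]; exact h'.cont
  have c3 : ContinuousOn v (uIcc 0 L) := by rw [uIcc_of_le hL]; exact h.cont_deriv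
  have c4 : ContinuousOn w (uIcc 0 L) := by rw [uIcc_of_le hL]; exact h'.cont_deriv
  have j1 := ((i1.mul_continuousOn c4).add (i4.continuousOn_mul c1)).mono_set hsub
  have j2 := ((i3.mul_continuousOn c2).add (i2.continuousOn_mul c3)).mono_set hsub
  rw [e1, e2, add_sub_add_comm, ← intervalIntegral.integral_sub j1 j2,
    ← intervalIntegral.integral_const_mul]
  congr 1
  apply intervalIntegral.integral_congr
  intro u _
  simp only
  ring

theorem wronskian (h : IsSol q L lam y v) (h' : IsSol q L lam z w)
    (hq : IntervalIntegrable q volume 0 L) {t : ℝ} (ht : t ∈ Icc 0 L) :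
    y t * w t - v t * z t = y 0 * w 0 - v 0 * z 0 := by
  simpa using h.lagrange h' hq ht

theorem conjugate (h : IsSol q L lam y v) :
    IsSol q L (conj lam) (fun t ↦ conj (y t)) (fun t ↦ conj (v t)) := by
  refine ⟨Complex.continuous_conj.comp_continuousOn h.cont,
    Complex.continuous_conj.comp_continuousOn h.cont_deriv, fun t ht ↦ ?_, fun t ht ↦ ?_⟩
  · rw [h.eq_integral t ht, map_add, intervalIntegral.integral_of_le ht.1,
      intervalIntegral.integral_of_le ht.1, integral_conj]
  · rw [h.deriv_eq_integral t ht, map_add, intervalIntegral.integral_of_le ht.1,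
      intervalIntegral.integral_of_le ht.1, ← integral_conj]
    simp

theorem add_mul (h : IsSol q L lam y v) (h' : IsSol q L lam z w)
    (hq : IntervalIntegrable q volume 0 L) (c : ℂ) :
    IsSol q L lam (fun t ↦ y t + c * z t) (fun t ↦ v t + c * w t) := by
  have hsub : ∀ t ∈ Icc 0 L, uIcc 0 t ⊆ uIcc 0 L := fun t ht ↦ by
    rw [uIcc_of_le (ht.1.trans ht.2), uIcc_of_le ht.1]; exact Icc_subset_Icc le_rfl ht.2
  refine ⟨h.cont.add (h'.cont.const_smul c), h.cont_deriv.add (h'.cont_deriv.const_smul c),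
    fun t ht ↦ ?_, fun t ht ↦ ?_⟩
  · have hL := ht.1.trans ht.2
    rw [intervalIntegral.integral_add ((h.intervalIntegrable_deriv hL).mono_set (hsub t ht))
      (((h'.intervalIntegrable_deriv hL).mono_set (hsub t ht)).const_mul c),
      intervalIntegral.integral_const_mul, h.eq_integral t ht, h'.eq_integral t ht]
    ring
  · have hL := ht.1.trans ht.2
    have : ∀ u, ((q u : ℂ) - lam) * (y u + c * z u)
      = ((q u : ℂ) - lam) * y u + c * (((q u : ℂ) - lam) * z u) := fun u ↦ by ring
    simp only [this]
    rw [intervalIntegral.integral_add ((h.intervalIntegrable_coeff hL hq).mono_set (hsub t ht))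
      (((h'.intervalIntegrable_coeff hL hq).mono_set (hsub t ht)).const_mul c),
      intervalIntegral.integral_const_mul, h.deriv_eq_integral t ht, h'.deriv_eq_integral t ht]
    ring

theorem im_conj_mul (h : IsSol q L lam y v) (hq : IntervalIntegrable q volume 0 L) {t : ℝ}
    (ht : t ∈ Icc 0 L) :
    (conj (y t) * v t).im
      = (conj (y 0) * v 0).im - lam.im * ∫ u in (0:ℝ)..t, ‖y u‖ ^ 2 := by
  have e := h.conjugate.lagrange h hq ht
  have e1 : ∀ u, conj (y u) * y u = ((‖y u‖ ^ 2 : ℝ) : ℂ) := fun u ↦ by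
    rw [mul_comm, Complex.mul_conj, Complex.normSq_eq_norm_sq]
  simp only [e1, intervalIntegral.integral_ofReal] at e
  have e2 := congrArg Complex.im e
  simp only [Complex.sub_im, Complex.add_im, Complex.mul_im, Complex.conj_re, Complex.conj_im,
    Complex.ofReal_re, Complex.ofReal_im, Complex.sub_re] at e2 ⊢
  linarith

theorem integral_norm_sq_pos (h : IsSol q L lam y v) {t : ℝ} (ht : t ∈ Icc 0 L) (ht0 : 0 < t)
    (hy : ∃ u ∈ Icc 0 t, y u ≠ 0) : 0 < ∫ u in (0:ℝ)..t, ‖y u‖ ^ 2 := by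
  refine intervalIntegral.integral_pos ht0 ?_ (fun _ _ ↦ by positivity) ?_
  · exact (h.cont.mono (Icc_subset_Icc le_rfl ht.2)).norm.pow 2
  · obtain ⟨u, hu, hne⟩ := hy
    exact ⟨u, hu, by positivity⟩

theorem hasDerivAt (h : IsSol q L lam y v) {t : ℝ} (ht : t ∈ Ioo 0 L) :
    HasDerivAt y (v t) t := by
  have hL := ht.1.trans ht.2
  have h1 : HasDerivAt (fun t ↦ y 0 + ∫ u in (0:ℝ)..t, v u) (v t) t := by
    refine (intervalIntegral.integral_hasDerivAt_right ?_ ?_ ?_).const_add _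
    · exact (h.intervalIntegrable_deriv hL.le).mono_set (by
        rw [uIcc_of_le hL.le, uIcc_of_le ht.1.le]; exact Icc_subset_Icc le_rfl ht.2.le)
    · exact (h.cont_deriv.mono Ioo_subset_Icc_self).stronglyMeasurableAtFilter isOpen_Ioo _ ht
    · exact h.cont_deriv.continuousAt (Icc_mem_nhds ht.1 ht.2)
  refine h1.congr_of_eventuallyEq ?_
  filter_upwards [Ioo_mem_nhds ht.1 ht.2] with s hs
  exact h.eq_integral s (Ioo_subset_Icc_self hs)

end IsSol

/-- A fundamental system of solutions of `-y'' + q y = lam y` on `[0, L]`, normalized at `0` and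
depending analytically on `lam`. -/
structure FundSys (q : ℝ → ℝ) (L : ℝ) where
  S : ℂ → ℝ → ℂ
  S' : ℂ → ℝ → ℂ
  C : ℂ → ℝ → ℂ
  C' : ℂ → ℝ → ℂ
  hS : ∀ lam, IsSol q L lam (S lam) (S' lam)
  hC : ∀ lam, IsSol q L lam (C lam) (C' lam)
  S_zero : ∀ lam, S lam 0 = 0
  S'_zero : ∀ lam, S' lam 0 = 1
  C_zero : ∀ lam, C lam 0 = 1
  C'_zero : ∀ lam, C' lam 0 = 0
  dS : ∀ t, Differentiable ℂ fun lam ↦ S lam t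
  dS' : ∀ t, Differentiable ℂ fun lam ↦ S' lam t
  dC : ∀ t, Differentiable ℂ fun lam ↦ C lam t
  dC' : ∀ t, Differentiable ℂ fun lam ↦ C' lam t

theorem nonempty_fundSys {q : ℝ → ℝ} {L : ℝ} (hL : 0 ≤ L)
    (hq : IntervalIntegrable q volume 0 L) : Nonempty (FundSys q L) := by
  obtain ⟨S, S', h1, h2, h3, h4, h5⟩ := exists_isSol hL hq 0 1
  obtain ⟨C, C', k1, k2, k3, k4, k5⟩ := exists_isSol hL hq 1 0
  exact ⟨⟨S, S', C, C', h1, k1, h2, h3, k2, k3, h4, h5, k4, k5⟩⟩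

namespace FundSys

variable {q : ℝ → ℝ} {L : ℝ} (F : FundSys q L)

theorem wronskian (hq : IntervalIntegrable q volume 0 L) (lam : ℂ) {t : ℝ} (ht : t ∈ Icc 0 L) :
    F.C lam t * F.S' lam t - F.C' lam t * F.S lam t = 1 := by
  simpa [F.S_zero, F.S'_zero, F.C_zero, F.C'_zero] using (F.hC lam).wronskian (F.hS lam) hq ht

theorem eq_add (hq : IntervalIntegrable q volume 0 L) {lam : ℂ} {y v : ℝ → ℂ}
    (h : IsSol q L lam y v) {t : ℝ} (ht : t ∈ Icc 0 L) :
    y t = y 0 * F.C lam t + v 0 * F.S lam t := by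
  have e1 := h.wronskian (F.hS lam) hq ht
  have e2 := h.wronskian (F.hC lam) hq ht
  have e3 := F.wronskian hq lam ht
  simp only [F.S_zero, F.S'_zero, F.C_zero, F.C'_zero] at e1 e2
  linear_combination F.C lam t * e1 - F.S lam t * e2 - y t * e3

theorem deriv_eq_add (hq : IntervalIntegrable q volume 0 L) {lam : ℂ} {y v : ℝ → ℂ}
    (h : IsSol q L lam y v) {t : ℝ} (ht : t ∈ Icc 0 L) :
    v t = y 0 * F.C' lam t + v 0 * F.S' lam t := by
  have e1 := h.wronskian (F.hS lam) hq ht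
  have e2 := h.wronskian (F.hC lam) hq ht
  have e3 := F.wronskian hq lam ht
  simp only [F.S_zero, F.S'_zero, F.C_zero, F.C'_zero] at e1 e2
  linear_combination F.C' lam t * e1 - F.S' lam t * e2 - v t * e3

theorem im_S (hq : IntervalIntegrable q volume 0 L) (lam : ℂ) {t : ℝ} (ht : t ∈ Icc 0 L) :
    (conj (F.S lam t) * F.S' lam t).im = - lam.im * ∫ u in (0:ℝ)..t, ‖F.S lam u‖ ^ 2 := by
  simpa [F.S_zero] using (F.hS lam).im_conj_mul hq ht

theorem im_C (hq : IntervalIntegrable q volume 0 L) (lam : ℂ) {t : ℝ} (ht : t ∈ Icc 0 L) :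
    (conj (F.C lam t) * F.C' lam t).im = - lam.im * ∫ u in (0:ℝ)..t, ‖F.C lam u‖ ^ 2 := by
  simpa [F.C_zero, F.C'_zero] using (F.hC lam).im_conj_mul hq ht

theorem exists_S_ne_zero (lam : ℂ) {t : ℝ} (ht : t ∈ Icc 0 L) (ht0 : 0 < t) :
    ∃ u ∈ Icc 0 t, F.S lam u ≠ 0 := by
  by_contra! H
  have hd : ∀ᶠ s in 𝓝[>] (0:ℝ), F.S' lam s = 0 := by
    filter_upwards [Ioo_mem_nhdsGT ht0] with s hs
    have h1 := (F.hS lam).hasDerivAt (t := s) ⟨hs.1, hs.2.trans_le ht.2⟩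
    have h2 : F.S lam =ᶠ[𝓝 s] fun _ ↦ (0:ℂ) := by
      filter_upwards [Ioo_mem_nhds hs.1 hs.2] with x hx
      exact H x ⟨hx.1.le, hx.2.le⟩
    exact h1.unique ((hasDerivAt_const s (0:ℂ)).congr_of_eventuallyEq h2)
  have hlim : Tendsto (F.S' lam) (𝓝[>] 0) (𝓝 (F.S' lam 0)) := by
    have h1 : Tendsto (F.S' lam) (𝓝[Icc 0 L] 0) (𝓝 (F.S' lam 0)) :=
      (F.hS lam).cont_deriv 0 ⟨le_rfl, ht.1.trans ht.2⟩
    refine h1.mono_left ?_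
    rw [← nhdsWithin_Ioo_eq_nhdsGT ht0]
    exact nhdsWithin_mono _ fun x hx ↦ ⟨hx.1.le, hx.2.le.trans ht.2⟩
  have := tendsto_nhds_unique (tendsto_const_nhds.congr' (hd.mono fun _ h ↦ h.symm)) hlim
  rw [F.S'_zero] at this
  exact zero_ne_one this

theorem im_S_mul_neg (hq : IntervalIntegrable q volume 0 L) {lam : ℂ} (hlam : lam.im ≠ 0) {t : ℝ}
    (ht : t ∈ Icc 0 L) (ht0 : 0 < t) :
    (conj (F.S lam t) * F.S' lam t).im * lam.im < 0 := by
  rw [F.im_S hq lam ht]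
  have := (F.hS lam).integral_norm_sq_pos ht ht0 (F.exists_S_ne_zero lam ht ht0)
  have h2 : 0 < lam.im * lam.im := mul_self_pos.mpr hlam
  nlinarith [mul_pos h2 this]

theorem im_C_mul_neg (hq : IntervalIntegrable q volume 0 L) {lam : ℂ} (hlam : lam.im ≠ 0) {t : ℝ}
    (ht : t ∈ Icc 0 L) (ht0 : 0 < t) :
    (conj (F.C lam t) * F.C' lam t).im * lam.im < 0 := by
  rw [F.im_C hq lam ht]
  have := (F.hC lam).integral_norm_sq_pos ht ht0 ⟨0, ⟨le_rfl, ht0.le⟩, by simp [F.C_zero]⟩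
  have h2 : 0 < lam.im * lam.im := mul_self_pos.mpr hlam
  nlinarith [mul_pos h2 this]

theorem S_ne_zero (hq : IntervalIntegrable q volume 0 L) {lam : ℂ} (hlam : lam.im ≠ 0) {t : ℝ}
    (ht : t ∈ Icc 0 L) (ht0 : 0 < t) : F.S lam t ≠ 0 := by
  intro h
  have := F.im_S_mul_neg hq hlam ht ht0
  simp [h] at this

theorem C_ne_zero (hq : IntervalIntegrable q volume 0 L) {lam : ℂ} (hlam : lam.im ≠ 0) {t : ℝ}
    (ht : t ∈ Icc 0 L) (ht0 : 0 < t) : F.C lam t ≠ 0 := by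
  intro h
  have := F.im_C_mul_neg hq hlam ht ht0
  simp [h] at this

end FundSys

end Solutions

section HerglotzNevanlinna

namespace RatHN

variable (f : RatHN)

/-- The complex-analytic continuation of `RatHN.eval`. -/
def cEval (z : ℂ) : ℂ := f.a * z + f.c + ∑ j, (f.γ j : ℂ) / (f.β j - z)

/-- The denominator polynomial of a rational Herglotz–Nevanlinna function. -/
def denom (z : ℂ) : ℂ := ∏ j, ((f.β j : ℂ) - z)

/-- The numerator polynomial of a rational Herglotz–Nevanlinna function. -/
def numer (z : ℂ) : ℂ :=
  (f.a * z + f.c) * f.denom z + ∑ j, (f.γ j : ℂ) * ∏ i ∈ Finset.univ.erase j, ((f.β i : ℂ) - z)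

theorem differentiable_denom : Differentiable ℂ f.denom := by
  unfold denom; fun_prop

theorem differentiable_numer : Differentiable ℂ f.numer := by
  have := f.differentiable_denom
  unfold numer; fun_prop

theorem denom_eq_zero_iff {z : ℂ} : f.denom z = 0 ↔ ∃ j, (f.β j : ℂ) = z := by
  simp [denom, Finset.prod_eq_zero_iff, sub_eq_zero]

theorem denom_ofReal_eq_zero_iff {x : ℝ} : f.denom x = 0 ↔ f.IsPole x := by
  simp [denom_eq_zero_iff, IsPole]

theorem denom_ne_zero {z : ℂ} (hz : z.im ≠ 0) : f.denom z ≠ 0 := by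
  rw [Ne, denom_eq_zero_iff]
  rintro ⟨j, rfl⟩
  simp at hz

theorem numer_eq {z : ℂ} (hz : f.denom z ≠ 0) : f.numer z = f.cEval z * f.denom z := by
  rw [numer, cEval, add_mul (_ + _) (Finset.sum _ _), Finset.sum_mul]
  congr 1
  refine Finset.sum_congr rfl fun j _ ↦ ?_
  have h : (f.β j : ℂ) - z ≠ 0 := fun h ↦ hz (f.denom_eq_zero_iff.mpr ⟨j, sub_eq_zero.mp h⟩)
  rw [denom, ← Finset.mul_prod_erase _ _ (Finset.mem_univ j)]
  field_simp

theorem numer_ne_zero {z : ℂ} (hz : f.denom z = 0) : f.numer z ≠ 0 := by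
  obtain ⟨j, rfl⟩ := f.denom_eq_zero_iff.mp hz
  rw [numer, hz, mul_zero, zero_add, Finset.sum_eq_single j]
  · refine mul_ne_zero (by exact_mod_cast (f.hγ j).ne') (Finset.prod_ne_zero_iff.mpr fun i hi ↦ ?_)
    rw [sub_ne_zero]
    exact_mod_cast fun h ↦ (Finset.ne_of_mem_erase hi) (f.hβ.injective h)
  · intro i _ hij
    rw [Finset.prod_eq_zero (i := j) (by simp [hij.symm]) (by simp), mul_zero]
  · simp

theorem cEval_ofReal (x : ℝ) : f.cEval x = (f.eval x : ℂ) := by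
  simp [cEval, eval]

theorem im_cEval_mul_nonneg (z : ℂ) : 0 ≤ (f.cEval z).im * z.im := by
  have e : ∀ j, ((f.γ j : ℂ) / (f.β j - z)).im = f.γ j / Complex.normSq (f.β j - z) * z.im := by
    intro j
    rw [Complex.div_im]
    simp
    ring
  simp only [cEval, Complex.add_im, Complex.im_sum, e, ← Finset.sum_mul]
  simp only [Complex.mul_im, Complex.ofReal_re, Complex.ofReal_im, zero_mul, add_zero]
  have h1 : 0 ≤ ∑ j, f.γ j / Complex.normSq (f.β j - z) :=
    Finset.sum_nonneg fun j _ ↦ div_nonneg (f.hγ j).le (Complex.normSq_nonneg _)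
  have h2 := f.ha
  have : (f.a * z.im + (∑ j, f.γ j / Complex.normSq (f.β j - z)) * z.im) * z.im
    = (f.a + ∑ j, f.γ j / Complex.normSq (f.β j - z)) * (z.im * z.im) := by ring
  rw [this]
  exact mul_nonneg (by linarith) (mul_self_nonneg _)

/-- The sum of the residues (up to sign) of `f` at `x`: it is `γ_j` at `β_j` and `0` elsewhere. -/
def residueAt (x : ℝ) : ℝ := ∑ j, if f.β j = x then f.γ j else 0

theorem residueAt_β (j : Fin f.n) : f.residueAt (f.β j) = f.γ j := by
  simp [residueAt, f.hβ.injective.eq_iff]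

theorem residueAt_ne_zero_iff (x : ℝ) : f.residueAt x ≠ 0 ↔ x ∈ range f.β := by
  constructor
  · intro h
    obtain ⟨j, -, hj⟩ := Finset.exists_ne_zero_of_sum_ne_zero h
    exact ⟨j, by by_contra h'; simp [h'] at hj⟩
  · rintro ⟨j, rfl⟩
    rw [residueAt_β]
    exact (f.hγ j).ne'

theorem tendsto_residue (x : ℝ) :
    Tendsto (fun t : ℝ ↦ -(t * Complex.I) * f.cEval (x + t * Complex.I)) (𝓝[>] 0)
      (𝓝 (f.residueAt x)) := by
  have hc : Continuous fun t : ℝ ↦ (t : ℂ) * Complex.I := by fun_prop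
  have hterm : ∀ j, Tendsto (fun t : ℝ ↦ -(t * Complex.I) *
      ((f.γ j : ℂ) / (f.β j - (x + t * Complex.I)))) (𝓝[>] 0)
      (𝓝 (if f.β j = x then (f.γ j : ℂ) else 0)) := by
    intro j
    split_ifs with h
    · refine tendsto_const_nhds.congr' ?_
      filter_upwards [self_mem_nhdsWithin] with t ht
      have ht' : (t : ℂ) ≠ 0 := by exact_mod_cast (ne_of_gt ht)
      rw [h, sub_add_cancel_left]
      field_simp
    · have h' : (f.β j : ℂ) - (x + (0:ℝ) * Complex.I) ≠ 0 := by
        simpa [sub_eq_zero] using h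
      have : ContinuousAt (fun t : ℝ ↦ -(t * Complex.I) *
          ((f.γ j : ℂ) / (f.β j - (x + t * Complex.I)))) 0 := by
        refine (by fun_prop : ContinuousAt (fun t : ℝ ↦ -(t * Complex.I)) 0).mul
          (continuousAt_const.div (by fun_prop) h')
      have h2 := this.tendsto
      simp only [Complex.ofReal_zero, zero_mul, neg_zero] at h2
      exact h2.mono_left nhdsWithin_le_nhds
  have hlin : Tendsto (fun t : ℝ ↦ -(t * Complex.I) * (f.a * (x + t * Complex.I) + f.c)) (𝓝[>] 0)
      (𝓝 0) := by
    have : Continuous fun t : ℝ ↦ -(t * Complex.I) * (f.a * (x + t * Complex.I) + f.c) := by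
      fun_prop
    have h2 := this.tendsto 0
    simp only [Complex.ofReal_zero, zero_mul, neg_zero] at h2
    exact h2.mono_left nhdsWithin_le_nhds
  have := hlin.add (tendsto_finsetSum Finset.univ fun j _ ↦ hterm j)
  rw [zero_add] at this
  convert! this using 2 with t
  · rw [cEval, mul_add, Finset.mul_sum]
  · rw [residueAt, Complex.ofReal_sum]
    exact Finset.sum_congr rfl fun j _ ↦ by split_ifs <;> simp

theorem ext_of_cEval {f g : RatHN} (h : ∀ z : ℂ, z.im ≠ 0 → f.cEval z = g.cEval z) : f = g := by
  have hres : ∀ x, f.residueAt x = g.residueAt x := by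
    intro x
    have h1 := f.tendsto_residue x
    have h2 := g.tendsto_residue x
    have : (f.residueAt x : ℂ) = g.residueAt x := by
      refine tendsto_nhds_unique h1 (h2.congr' ?_)
      filter_upwards [self_mem_nhdsWithin] with t ht
      rw [h]
      simpa using (ne_of_gt ht)
    exact_mod_cast this
  have hrange : range f.β = range g.β := by
    ext x
    rw [← residueAt_ne_zero_iff, ← residueAt_ne_zero_iff, hres]
  have hn : f.n = g.n := by
    have h1 := Nat.card_range_of_injective f.hβ.injective
    have h2 := Nat.card_range_of_injective g.hβ.injective
    rw [hrange] at h1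
    rw [h1, Nat.card_fin, Nat.card_fin] at h2
    exact h2
  obtain ⟨a, c, n, γ, β, ha, hγ, hβ⟩ := f
  obtain ⟨a', c', n', γ', β', ha', hγ', hβ'⟩ := g
  simp only at hn
  subst hn
  have hβe : β = β' := (hβ.range_inj hβ').mp hrange
  subst hβe
  have hγe : γ = γ' := by
    funext j
    have := hres (β j)
    rwa [residueAt_β ⟨a, c, n, γ, β, ha, hγ, hβ⟩ j,
      residueAt_β ⟨a', c', n, γ', β, ha', hγ', hβ'⟩ j] at this
  subst hγe
  have h1 := h Complex.I (by simp)
  have h2 := h (2 * Complex.I) (by simp)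
  simp only [cEval, add_left_inj] at h1 h2
  have h1r := congrArg Complex.re h1
  have h1i := congrArg Complex.im h1
  simp at h1r h1i
  subst h1r h1i
  rfl

end RatHN

end HerglotzNevanlinna

section Reflection

theorem IsCaraSol.reflect {Q : ℝ → ℝ} {L lam : ℝ} {y y' : ℝ → ℝ} (h : IsCaraSol Q L lam y y')
    (hQ : IntervalIntegrable Q volume 0 L) :
    IsCaraSol (fun t ↦ Q (L - t)) L lam (fun t ↦ y (L - t)) (fun t ↦ -y' (L - t)) := by
  obtain ⟨h1, h2, h3, h4⟩ := h
  have hm : MapsTo (fun t ↦ L - t) (Icc 0 L) (Icc 0 L) := fun t ht ↦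
    ⟨by linarith [ht.2], by linarith [ht.1]⟩
  have hc : ContinuousOn (fun t ↦ L - t) (Icc 0 L) := by fun_prop
  refine ⟨h1.comp hc hm, (h2.comp hc hm).neg, fun t ht ↦ ?_, fun t ht ↦ ?_⟩
  all_goals
    have hL : 0 ≤ L := ht.1.trans ht.2
    have hs1 : uIcc 0 (L - t) ⊆ uIcc 0 L := by
      rw [uIcc_of_le hL, uIcc_of_le (hm ht).1]; exact Icc_subset_Icc le_rfl (hm ht).2
    have hLm : L ∈ Icc 0 L := ⟨hL, le_rfl⟩
  · have hi : IntervalIntegrable y' volume 0 L := by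
      apply ContinuousOn.intervalIntegrable; rwa [uIcc_of_le hL]
    change y (L - t) = y (L - 0) + ∫ u in (0:ℝ)..t, -y' (L - u)
    rw [intervalIntegral.integral_neg, intervalIntegral.integral_comp_sub_left, sub_zero,
      h3 (L - t) (hm ht), h3 L hLm, ← intervalIntegral.integral_interval_sub_left hi (hi.mono_set hs1)]
    ring
  · have hi : IntervalIntegrable (fun u ↦ (Q u - lam) * y u) volume 0 L := by
      apply (hQ.sub intervalIntegrable_const).mul_continuousOn; rwa [uIcc_of_le hL]
    change -y' (L - t) = -y' (L - 0) + ∫ u in (0:ℝ)..t, (Q (L - u) - lam) * y (L - u)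
    rw [intervalIntegral.integral_comp_sub_left (fun u ↦ (Q u - lam) * y u), sub_zero,
      h4 (L - t) (hm ht), h4 L hLm, ← intervalIntegral.integral_interval_sub_left hi (hi.mono_set hs1)]
    ring

theorem IsCaraSol.isSol {Q : ℝ → ℝ} {L lam : ℝ} {y y' : ℝ → ℝ} (h : IsCaraSol Q L lam y y') :
    IsSol Q L lam (fun t ↦ (y t : ℂ)) (fun t ↦ (y' t : ℂ)) := by
  obtain ⟨h1, h2, h3, h4⟩ := h
  refine ⟨Complex.continuous_ofReal.comp_continuousOn h1,
    Complex.continuous_ofReal.comp_continuousOn h2, fun t ht ↦ ?_, fun t ht ↦ ?_⟩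
  · rw [intervalIntegral.integral_ofReal, ← Complex.ofReal_add, ← h3 t ht]
  · simp only [← Complex.ofReal_sub, ← Complex.ofReal_mul]
    rw [intervalIntegral.integral_ofReal, ← Complex.ofReal_add, ← h4 t ht]

theorem IsSol.isCaraSol {Q : ℝ → ℝ} {L lam : ℝ} {y v : ℝ → ℂ} (h : IsSol Q L lam y v)
    (hQ : IntervalIntegrable Q volume 0 L) :
    IsCaraSol Q L lam (fun t ↦ (y t).re) (fun t ↦ (v t).re) := by
  have hsub : ∀ t ∈ Icc 0 L, uIcc 0 t ⊆ uIcc 0 L := fun t ht ↦ by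
    rw [uIcc_of_le (ht.1.trans ht.2), uIcc_of_le ht.1]; exact Icc_subset_Icc le_rfl ht.2
  refine ⟨Complex.continuous_re.comp_continuousOn h.cont,
    Complex.continuous_re.comp_continuousOn h.cont_deriv, fun t ht ↦ ?_, fun t ht ↦ ?_⟩
  · change (y t).re = (y 0).re + ∫ u in (0:ℝ)..t, (v u).re
    rw [h.eq_integral t ht, Complex.add_re]
    have := Complex.reCLM.intervalIntegral_comp_comm
      ((h.intervalIntegrable_deriv (ht.1.trans ht.2)).mono_set (hsub t ht))
    simp only [Complex.reCLM_apply] at this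
    rw [this]
  · change (v t).re = (v 0).re + ∫ u in (0:ℝ)..t, (Q u - lam) * (y u).re
    rw [h.deriv_eq_integral t ht, Complex.add_re]
    have := Complex.reCLM.intervalIntegral_comp_comm
      ((h.intervalIntegrable_coeff (ht.1.trans ht.2) hQ).mono_set (hsub t ht))
    simp only [Complex.reCLM_apply] at this
    rw [← this]
    simp

end Reflection

section Characteristic

open scoped ComplexConjugate

namespace FundSys

variable {q : ℝ → ℝ} {L : ℝ} (F : FundSys q L) (f : RatHN)

theorem S_conj (hq : IntervalIntegrable q volume 0 L) (lam : ℂ) {t : ℝ} (ht : t ∈ Icc 0 L) :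
    conj (F.S lam t) = F.S (conj lam) t := by
  simpa [F.S_zero, F.S'_zero] using F.eq_add hq (F.hS lam).conjugate ht

/-- The characteristic function of the problem with a Dirichlet condition at `0`. -/
def charS (lam : ℂ) : ℂ := f.denom lam * F.S' lam L - f.numer lam * F.S lam L

/-- The characteristic function of the problem with a Neumann condition at `0`. -/
def charC (lam : ℂ) : ℂ := f.denom lam * F.C' lam L - f.numer lam * F.C lam L

theorem differentiable_charS : Differentiable ℂ (F.charS f) :=
  (f.differentiable_denom.mul (F.dS' L)).sub (f.differentiable_numer.mul (F.dS L))

theorem differentiable_charC : Differentiable ℂ (F.charC f) :=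
  (f.differentiable_denom.mul (F.dC' L)).sub (f.differentiable_numer.mul (F.dC L))

theorem denom_eq (hq : IntervalIntegrable q volume 0 L) (hL : 0 ≤ L) (lam : ℂ) :
    f.denom lam = F.charS f lam * F.C lam L - F.charC f lam * F.S lam L := by
  have := F.wronskian hq lam (t := L) ⟨hL, le_rfl⟩
  rw [charS, charC]
  linear_combination -f.denom lam * this

theorem numer_eq (hq : IntervalIntegrable q volume 0 L) (hL : 0 ≤ L) (lam : ℂ) :
    f.numer lam = F.charS f lam * F.C' lam L - F.charC f lam * F.S' lam L := by
  have := F.wronskian hq lam (t := L) ⟨hL, le_rfl⟩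
  rw [charS, charC]
  linear_combination -f.numer lam * this

theorem charC_ne_zero_of_charS (hq : IntervalIntegrable q volume 0 L) (hL : 0 ≤ L) {lam : ℂ}
    (h : F.charS f lam = 0) : F.charC f lam ≠ 0 := by
  intro h'
  refine f.numer_ne_zero (z := lam) ?_ ?_
  · rw [F.denom_eq f hq hL, h, h']; simp
  · rw [F.numer_eq f hq hL, h, h']; simp

theorem charS_ne_zero (hq : IntervalIntegrable q volume 0 L) (hL : 0 < L) {lam : ℂ}
    (hlam : lam.im ≠ 0) : F.charS f lam ≠ 0 := by
  intro h
  have hr := f.denom_ne_zero hlam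
  rw [charS, f.numer_eq hr] at h
  have h1 : F.S' lam L = f.cEval lam * F.S lam L :=
    mul_left_cancel₀ hr (by linear_combination h)
  have h2 := F.im_S_mul_neg hq hlam (t := L) ⟨hL.le, le_rfl⟩ hL
  have h3 : conj (F.S lam L) * F.S' lam L = f.cEval lam * (Complex.normSq (F.S lam L) : ℝ) := by
    rw [h1, ← Complex.mul_conj]; ring
  rw [h3, Complex.im_mul_ofReal] at h2
  have := mul_nonneg (f.im_cEval_mul_nonneg lam) (Complex.normSq_nonneg (F.S lam L))
  nlinarith

theorem charC_ne_zero (hq : IntervalIntegrable q volume 0 L) (hL : 0 < L) {lam : ℂ}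
    (hlam : lam.im ≠ 0) : F.charC f lam ≠ 0 := by
  intro h
  have hr := f.denom_ne_zero hlam
  rw [charC, f.numer_eq hr] at h
  have h1 : F.C' lam L = f.cEval lam * F.C lam L :=
    mul_left_cancel₀ hr (by linear_combination h)
  have h2 := F.im_C_mul_neg hq hlam (t := L) ⟨hL.le, le_rfl⟩ hL
  have h3 : conj (F.C lam L) * F.C' lam L = f.cEval lam * (Complex.normSq (F.C lam L) : ℝ) := by
    rw [h1, ← Complex.mul_conj]; ring
  rw [h3, Complex.im_mul_ofReal] at h2
  have := mul_nonneg (f.im_cEval_mul_nonneg lam) (Complex.normSq_nonneg (F.C lam L))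
  nlinarith

/-- The Weyl function. -/
def weyl (lam : ℂ) : ℂ := -F.charC f lam / F.charS f lam

/-- The Weyl solution. -/
def weylSol (lam : ℂ) (t : ℝ) : ℂ := F.C lam t + F.weyl f lam * F.S lam t

/-- The derivative of the Weyl solution. -/
def weylSol' (lam : ℂ) (t : ℝ) : ℂ := F.C' lam t + F.weyl f lam * F.S' lam t

theorem isSol_weylSol (hq : IntervalIntegrable q volume 0 L) (lam : ℂ) :
    IsSol q L lam (F.weylSol f lam) (F.weylSol' f lam) :=
  (F.hC lam).add_mul (F.hS lam) hq _

theorem weylSol_end (hq : IntervalIntegrable q volume 0 L) (hL : 0 < L) {lam : ℂ}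
    (hlam : lam.im ≠ 0) : F.weylSol f lam L = f.denom lam / F.charS f lam := by
  have := F.charS_ne_zero f hq hL hlam
  rw [F.denom_eq f hq hL.le, weylSol, weyl]
  field_simp
  ring

theorem weylSol'_end (hq : IntervalIntegrable q volume 0 L) (hL : 0 < L) {lam : ℂ}
    (hlam : lam.im ≠ 0) : F.weylSol' f lam L = f.cEval lam * F.weylSol f lam L := by
  have := F.charS_ne_zero f hq hL hlam
  rw [F.weylSol_end f hq hL hlam, ← mul_div_assoc, ← f.numer_eq (f.denom_ne_zero hlam),
    F.numer_eq f hq hL.le, weylSol', weyl]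
  field_simp
  ring

theorem weylSol_zero (lam : ℂ) : F.weylSol f lam 0 = 1 := by
  simp [weylSol, F.C_zero, F.S_zero]

theorem weylSol'_zero (lam : ℂ) : F.weylSol' f lam 0 = F.weyl f lam := by
  simp [weylSol', F.C'_zero, F.S'_zero]

theorem im_weylSol_end (hq : IntervalIntegrable q volume 0 L) (hL : 0 < L) {lam : ℂ}
    (hlam : lam.im ≠ 0) :
    0 ≤ (conj (F.weylSol f lam L) * F.weylSol' f lam L).im * lam.im := by
  have h3 : conj (F.weylSol f lam L) * F.weylSol' f lam L
      = f.cEval lam * (Complex.normSq (F.weylSol f lam L) : ℝ) := by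
    rw [F.weylSol'_end f hq hL hlam, ← Complex.mul_conj]; ring
  rw [h3, Complex.im_mul_ofReal]
  have := mul_nonneg (f.im_cEval_mul_nonneg lam) (Complex.normSq_nonneg (F.weylSol f lam L))
  linarith

theorem im_weyl_mul_pos (hq : IntervalIntegrable q volume 0 L) (hL : 0 < L) {lam : ℂ}
    (hlam : lam.im ≠ 0) : 0 < (F.weyl f lam).im * lam.im := by
  have hLm : L ∈ Icc 0 L := ⟨hL.le, le_rfl⟩
  have h1 := (F.isSol_weylSol f hq lam).im_conj_mul hq hLm
  have h2 := (F.isSol_weylSol f hq lam).integral_norm_sq_pos hLm hL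
    ⟨0, ⟨le_rfl, hL.le⟩, by simp [weylSol_zero]⟩
  have h3 := F.im_weylSol_end f hq hL hlam
  rw [h1, weylSol_zero, weylSol'_zero, map_one, one_mul] at h3
  have h4 : 0 < lam.im * lam.im := mul_self_pos.mpr hlam
  nlinarith [mul_pos h4 h2]

theorem im_weylSol_nonneg (hq : IntervalIntegrable q volume 0 L) (hL : 0 < L) {lam : ℂ}
    (hlam : lam.im ≠ 0) {t : ℝ} (ht : t ∈ Icc 0 L) :
    0 ≤ (conj (F.weylSol f lam t) * F.weylSol' f lam t).im * lam.im := by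
  have hLm : L ∈ Icc 0 L := ⟨hL.le, le_rfl⟩
  have hs := F.isSol_weylSol f hq lam
  have h1 := hs.im_conj_mul hq hLm
  have h1' := hs.im_conj_mul hq ht
  have h3 := F.im_weylSol_end f hq hL hlam
  have h4 : 0 < lam.im * lam.im := mul_self_pos.mpr hlam
  have h5 : ∫ u in (0:ℝ)..t, ‖F.weylSol f lam u‖ ^ 2
      ≤ ∫ u in (0:ℝ)..L, ‖F.weylSol f lam u‖ ^ 2 := by
    refine intervalIntegral.integral_mono_interval le_rfl ht.1 ht.2
      (Eventually.of_forall fun _ ↦ by positivity) ?_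
    apply ContinuousOn.intervalIntegrable
    rw [uIcc_of_le hL.le]
    exact hs.cont.norm.pow 2
  rw [h1] at h3
  rw [h1']
  have := mul_le_mul_of_nonneg_left h5 h4.le
  linarith

end FundSys

section Eigenvalues

variable {q : ℝ → ℝ} (F : FundSys (fun t ↦ q (Real.pi - t)) Real.pi) (f : RatHN)

theorem IntervalIntegrable.reflect {q : ℝ → ℝ} {L : ℝ} (hq : IntervalIntegrable q volume 0 L) :
    IntervalIntegrable (fun t ↦ q (L - t)) volume 0 L := by
  simpa using (hq.comp_sub_left L).symm

theorem IsEigen.exists_isSol {b : Option ℝ} {lam : ℝ} (hq : IntervalIntegrable q volume 0 Real.pi)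
    (h : IsEigen q f b lam) : ∃ Y V : ℝ → ℂ, IsSol (fun t ↦ q (Real.pi - t)) Real.pi lam Y V ∧
      (∃ t ∈ Icc 0 Real.pi, Y t ≠ 0) ∧
      f.denom lam * V Real.pi = f.numer lam * Y Real.pi ∧
      (b = none → Y 0 = 0) ∧ (b = some 0 → V 0 = 0) := by
  obtain ⟨y, y', h1, ⟨x, hx, hxy⟩, h3, h4, h5, h6⟩ := h
  refine ⟨_, _, (h1.reflect hq).isSol, ⟨Real.pi - x, ⟨by linarith [hx.2], by linarith [hx.1]⟩,
    by simpa using hxy⟩, ?_, fun hb ↦ ?_, fun hb ↦ ?_⟩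
  · by_cases hp : f.IsPole lam
    · simp [h4 hp, f.denom_ofReal_eq_zero_iff.mpr hp]
    · rw [f.numer_eq (by rwa [Ne, f.denom_ofReal_eq_zero_iff]), f.cEval_ofReal, sub_self, h3 hp]
      push_cast
      ring
  · simp [h6 hb]
  · simp [h5 0 hb]

theorem IsSol.isEigen {b : Option ℝ} {lam : ℝ} (hq : IntervalIntegrable q volume 0 Real.pi)
    {Y V : ℝ → ℂ} (h : IsSol (fun t ↦ q (Real.pi - t)) Real.pi lam Y V)
    (h0 : ∃ t ∈ Icc 0 Real.pi, (Y t).re ≠ 0)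
    (hpi : f.denom lam * V Real.pi = f.numer lam * Y Real.pi)
    (hn : b = none → Y 0 = 0) (hs : ∀ bb, b = some bb → bb = 0 ∧ V 0 = 0) :
    IsEigen q f b lam := by
  have h1 := (h.isCaraSol hq.reflect).reflect hq.reflect
  simp only [sub_sub_cancel] at h1
  obtain ⟨t, ht, hne⟩ := h0
  refine ⟨_, _, h1, ⟨Real.pi - t, ⟨by linarith [ht.2], by linarith [ht.1]⟩, by simpa using hne⟩,
    fun hp ↦ ?_, fun hp ↦ ?_, fun bb hb ↦ ?_, fun hb ↦ ?_⟩
  · have hd : f.denom lam ≠ 0 := by rwa [Ne, f.denom_ofReal_eq_zero_iff]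
    rw [f.numer_eq hd, f.cEval_ofReal] at hpi
    have : V Real.pi = f.eval lam * Y Real.pi := mul_left_cancel₀ hd (by linear_combination hpi)
    simp [this]
  · have hd := f.denom_ofReal_eq_zero_iff.mpr hp
    rw [hd, zero_mul] at hpi
    have := (mul_eq_zero.mp hpi.symm).resolve_left (f.numer_ne_zero hd)
    simp [this]
  · obtain ⟨rfl, hV⟩ := hs bb hb
    simp [hV]
  · simp [hn hb]

theorem isEigen_none_iff (hq : IntervalIntegrable q volume 0 Real.pi) (lam : ℝ) :
    IsEigen q f none lam ↔ F.charS f lam = 0 := by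
  have hpi : Real.pi ∈ Icc 0 Real.pi := ⟨Real.pi_pos.le, le_rfl⟩
  constructor
  · intro h
    obtain ⟨Y, V, h1, ⟨t, ht, hne⟩, h3, h4, -⟩ := h.exists_isSol f hq
    have hY0 := h4 rfl
    have hV0 : V 0 ≠ 0 := by
      intro hV
      rw [F.eq_add hq.reflect h1 ht] at hne
      simp [hY0, hV] at hne
    rw [F.eq_add hq.reflect h1 hpi, F.deriv_eq_add hq.reflect h1 hpi, hY0] at h3
    refine mul_left_cancel₀ hV0 ?_
    rw [FundSys.charS]
    linear_combination h3
  · intro h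
    obtain ⟨t, ht, hne⟩ := F.exists_S_ne_zero lam hpi Real.pi_pos
    refine (F.hS lam).isEigen f hq ⟨t, ht, fun hre ↦ hne ?_⟩ (sub_eq_zero.mp h)
      (fun _ ↦ F.S_zero lam) (by simp)
    have := F.S_conj hq.reflect lam ht
    rw [Complex.conj_ofReal, Complex.conj_eq_iff_im] at this
    exact Complex.ext hre this

theorem isEigen_zero_iff (hq : IntervalIntegrable q volume 0 Real.pi) (lam : ℝ) :
    IsEigen q f (some 0) lam ↔ F.charC f lam = 0 := by
  have hpi : Real.pi ∈ Icc 0 Real.pi := ⟨Real.pi_pos.le, le_rfl⟩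
  constructor
  · intro h
    obtain ⟨Y, V, h1, ⟨t, ht, hne⟩, h3, -, h4⟩ := h.exists_isSol f hq
    have hV0 := h4 rfl
    have hY0 : Y 0 ≠ 0 := by
      intro hV
      rw [F.eq_add hq.reflect h1 ht] at hne
      simp [hV0, hV] at hne
    rw [F.eq_add hq.reflect h1 hpi, F.deriv_eq_add hq.reflect h1 hpi, hV0] at h3
    refine mul_left_cancel₀ hY0 ?_
    rw [FundSys.charC]
    linear_combination h3
  · intro h
    refine (F.hC lam).isEigen f hq ⟨0, ⟨le_rfl, Real.pi_pos.le⟩, by simp [F.C_zero]⟩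
      (sub_eq_zero.mp h) (by simp) (fun bb hb ↦ ⟨by simpa using hb.symm, F.C'_zero lam⟩)

end Eigenvalues

end Characteristic

section EntireFunctions

/-- An analytic function mapping the upper half plane to itself near a real zero has a nonzero
derivative there. -/
theorem deriv_ne_zero_of_im_pos {g : ℂ → ℂ} {x : ℝ} (hg : AnalyticAt ℂ g x) (hgx : g x = 0)
    (him : ∀ z : ℂ, 0 < z.im → 0 < (g z).im) : deriv g x ≠ 0 := by
  have hray : ∀ w : ℂ, Tendsto (fun ρ : ℝ ↦ (x : ℂ) + ρ * w) (𝓝[>] 0) (𝓝 x) := by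
    intro w
    have : Continuous fun ρ : ℝ ↦ (x : ℂ) + ρ * w := by fun_prop
    have h := this.tendsto 0
    simp only [Complex.ofReal_zero, zero_mul, add_zero] at h
    exact h.mono_left nhdsWithin_le_nhds
  have hne : ¬∀ᶠ z in 𝓝 (x : ℂ), g z = 0 := by
    intro h
    obtain ⟨ρ, h1, h2⟩ := (((hray Complex.I).eventually h).and self_mem_nhdsWithin).exists
    have := him (x + ρ * Complex.I) (by simpa using h2)
    simp [h1] at this
  obtain ⟨n, h, hh, hhx, heq⟩ := hg.exists_eventuallyEq_pow_smul_nonzero_iff.mpr hne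
  intro hd
  have hn2 : 2 ≤ n := by
    by_contra! hn
    interval_cases n
    · have := heq.self_of_nhds
      simp [hgx] at this
      exact hhx this.symm
    · have h1 : HasDerivAt (fun z : ℂ ↦ (z - x) ^ 1 • h z) (h x) x := by
        have := ((hasDerivAt_id (x : ℂ)).sub_const (x : ℂ)).mul hh.differentiableAt.hasDerivAt
        simpa using! this
      have h2 := (h1.congr_of_eventuallyEq heq).deriv
      exact hhx (h2.symm.trans hd)
  have hlim : ∀ w : ℂ, 0 < w.im → 0 ≤ (w ^ n * h x).im := by
    intro w hw
    have ht : Tendsto (fun ρ : ℝ ↦ (w ^ n * h (x + ρ * w)).im) (𝓝[>] 0) (𝓝 (w ^ n * h x).im) :=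
      Complex.continuous_im.continuousAt.tendsto.comp
        ((hh.continuousAt.tendsto.comp (hray w)).const_mul (w ^ n))
    refine ge_of_tendsto ht ?_
    filter_upwards [(hray w).eventually heq, self_mem_nhdsWithin] with ρ h1 h2
    have hρ : 0 < ρ := h2
    have h3 := him (x + ρ * w) (by simpa using mul_pos hρ hw)
    have h4 : g (x + ρ * w) = ((ρ ^ n : ℝ) : ℂ) * (w ^ n * h (x + ρ * w)) := by
      rw [h1, add_sub_cancel_left, mul_pow, smul_eq_mul]
      push_cast
      ring
    rw [h4, Complex.im_ofReal_mul] at h3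
    exact (pos_of_mul_pos_right h3 (by positivity)).le
  have hang : ∀ α : ℝ, 0 < α → α < 2 * Real.pi →
      0 ≤ Real.cos α * (h x).im + Real.sin α * (h x).re := by
    intro α h0 h1
    have hn : (2:ℝ) ≤ n := by exact_mod_cast hn2
    have hn0 : (n : ℂ) ≠ 0 := by
      have : n ≠ 0 := by omega
      exact_mod_cast this
    have h2 := hlim (Complex.exp ((α / n : ℝ) * Complex.I)) (by
      rw [Complex.exp_ofReal_mul_I_im]
      apply Real.sin_pos_of_pos_of_lt_pi (by positivity)
      rw [div_lt_iff₀ (by linarith)]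
      nlinarith [Real.pi_pos])
    rw [← Complex.exp_nat_mul] at h2
    have h3 : (n : ℂ) * ((α / n : ℝ) * Complex.I) = α * Complex.I := by
      push_cast
      field_simp
    rw [h3, Complex.mul_im, Complex.exp_ofReal_mul_I_re, Complex.exp_ofReal_mul_I_im] at h2
    exact h2
  have hpi := Real.pi_pos
  have a1 := hang (Real.pi / 2) (by linarith) (by linarith)
  have a2 := hang (Real.pi / 2 + Real.pi) (by linarith) (by linarith)
  have a3 := hang Real.pi (by linarith) (by linarith)
  have a4 := hang (Real.pi / 4) (by linarith) (by linarith)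
  simp [Real.sin_add_pi, Real.cos_add_pi] at a1 a2 a3
  have hre : (h x).re = 0 := le_antisymm a2 a1
  rw [hre, mul_zero, add_zero, Real.cos_pi_div_four] at a4
  have him0 : 0 ≤ (h x).im := (mul_nonneg_iff_of_pos_left (by positivity)).mp a4
  exact hhx (Complex.ext hre (le_antisymm a3 him0))

/-- The quotient of two entire functions with the same, simple, zeros is entire and zero-free. -/
theorem exists_entire_quotient {A B : ℂ → ℂ} (hA : Differentiable ℂ A) (hB : Differentiable ℂ B)
    (hAB : ∀ z, A z = 0 ↔ B z = 0) (hA' : ∀ z, A z = 0 → deriv A z ≠ 0)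
    (hB' : ∀ z, B z = 0 → deriv B z ≠ 0) :
    ∃ E : ℂ → ℂ, Differentiable ℂ E ∧ (∀ z, E z ≠ 0) ∧ ∀ z, A z = E z * B z := by
  classical
  refine ⟨fun z ↦ if B z = 0 then deriv A z / deriv B z else A z / B z, fun z₀ ↦ ?_, fun z ↦ ?_,
    fun z ↦ ?_⟩
  · by_cases h : B z₀ = 0
    · have dd : ∀ {G : ℂ → ℂ}, Differentiable ℂ G → DifferentiableAt ℂ (dslope G z₀) z₀ :=
        fun hG ↦ ((Complex.differentiableOn_dslope univ_mem).mpr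
          hG.differentiableOn).differentiableAt univ_mem
      have hs : dslope B z₀ z₀ ≠ 0 := by rw [dslope_same]; exact hB' z₀ h
      refine ((dd hA).div (dd hB) hs).congr_of_eventuallyEq ?_
      filter_upwards [(dd hB).continuousAt.eventually_ne hs] with w hw
      by_cases hwz : w = z₀
      · simp [hwz, h]
      · have hzw : w - z₀ ≠ 0 := sub_ne_zero.mpr hwz
        rw [dslope_of_ne _ hwz, slope_def_field, h, sub_zero] at hw
        have hBw : B w ≠ 0 := fun h' ↦ hw (by simp [h'])
        rw [if_neg hBw, Pi.div_apply, dslope_of_ne _ hwz, dslope_of_ne _ hwz, slope_def_field,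
          slope_def_field, h, (hAB z₀).mpr h, sub_zero, sub_zero]
        field_simp
    · refine ((hA z₀).div (hB z₀) h).congr_of_eventuallyEq ?_
      filter_upwards [(hB z₀).continuousAt.eventually_ne h] with w hw
      simp [hw]
  · by_cases h : B z = 0
    · simp [h, hB' z h, hA' z ((hAB z).mpr h)]
    · simp [h, mt (hAB z).mp h]
  · by_cases h : B z = 0
    · simp [h, (hAB z).mpr h]
    · simp [h]

theorem abs_sub_lt_of_isPreconnected {s : Set ℝ} (hs : IsPreconnected s)
    (h : ∀ x ∈ s, ∀ k : ℤ, x ≠ Real.pi + k * (2 * Real.pi)) {x y : ℝ} (hx : x ∈ s) (hy : y ∈ s) :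
    |x - y| < 2 * Real.pi := by
  have key : ∀ x ∈ s, ∀ y ∈ s, x - y < 2 * Real.pi := by
    intro x hx y hy
    by_contra! hxy
    have hpi := Real.pi_pos
    have h1 := Int.le_ceil ((y - Real.pi) / (2 * Real.pi))
    have h2 := Int.ceil_lt_add_one ((y - Real.pi) / (2 * Real.pi))
    rw [div_le_iff₀ (by positivity)] at h1
    rw [← sub_lt_iff_lt_add, lt_div_iff₀ (by positivity)] at h2
    exact h _ (hs.ordConnected.out hy hx ⟨by linarith, by linarith⟩) _ rfl
  rw [abs_lt]
  exact ⟨by linarith [key y hy x hx], key x hx y hy⟩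

/-- A zero-free entire function that takes no negative values off the real line is constant. -/
theorem eq_const_of_mem_slitPlane {h : ℂ → ℂ} (hh : Differentiable ℂ h) (h0 : ∀ z, h z ≠ 0)
    (hs : ∀ z : ℂ, z.im ≠ 0 → h z ∈ Complex.slitPlane) (z w : ℂ) : h z = h w := by
  obtain ⟨H, hH⟩ := (hh.deriv.div hh h0).isExactOn_univ
  replace hH : ∀ z, HasDerivAt H (deriv h z / h z) z := fun z ↦ hH z (mem_univ z)
  have hconst : ∀ z w, h z * Complex.exp (-H z) = h w * Complex.exp (-H w) := by
    refine is_const_of_deriv_eq_zero (fun z ↦ ?_) fun z ↦ ?_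
    · exact (hh z).mul (hH z).differentiableAt.neg.cexp
    · refine ((hh z).hasDerivAt.mul (hH z).neg.cexp).deriv.trans ?_
      have := h0 z
      simp only [Pi.neg_apply]
      field_simp
      ring
  obtain ⟨c, hc⟩ : ∃ c, Complex.exp c = h 0 * Complex.exp (-H 0) :=
    ⟨_, Complex.exp_log (mul_ne_zero (h0 0) (Complex.exp_ne_zero _))⟩
  have hexp : ∀ z, h z = Complex.exp (H z + c) := by
    intro z
    rw [Complex.exp_add, hc, ← hconst z 0, mul_left_comm, ← Complex.exp_add]
    simp
  have havoid : ∀ z : ℂ, z.im ≠ 0 → ∀ k : ℤ, (H z + c).im ≠ Real.pi + k * (2 * Real.pi) := by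
    intro z hz k hk
    have h1 := hs z hz
    rw [hexp z, Complex.mem_slitPlane_iff, Complex.exp_re, Complex.exp_im, hk,
      Real.cos_add_int_mul_two_pi, Real.sin_add_int_mul_two_pi, Real.cos_pi, Real.sin_pi] at h1
    have := Real.exp_pos (H z + c).re
    rcases h1 with h1 | h1
    · linarith
    · simp at h1
  have hcH : Continuous H := continuous_iff_continuousAt.mpr fun z ↦ (hH z).continuousAt
  have hcont : Continuous fun z ↦ (H z + c).im := Complex.continuous_im.comp (by fun_prop)
  have hhalf : ∀ s : Set ℂ, Convex ℝ s → (∀ z ∈ s, z.im ≠ 0) → ∀ z ∈ s, ∀ w ∈ s,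
      |(H z + c).im - (H w + c).im| < 2 * Real.pi := by
    intro s hsc hsim z hz w hw
    refine abs_sub_lt_of_isPreconnected (hsc.isPreconnected.image _ hcont.continuousOn) ?_
      (mem_image_of_mem _ hz) (mem_image_of_mem _ hw)
    rintro _ ⟨u, hu, rfl⟩
    exact havoid u (hsim u hu)
  set B := max |(H Complex.I + c).im| |(H (-Complex.I) + c).im| + 2 * Real.pi with hB
  have hb1 : ∀ z : ℂ, z.im ≠ 0 → (H z + c).im ≤ B := by
    intro z hz
    rcases lt_or_gt_of_ne hz with h1 | h1
    · have := hhalf _ (convex_halfSpace_im_lt 0) (fun z hz ↦ ne_of_lt hz) z h1 (-Complex.I)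
        (by simp)
      have h2 := le_max_right |(H Complex.I + c).im| |(H (-Complex.I) + c).im|
      have h3 := le_abs_self (H (-Complex.I) + c).im
      have h4 := (abs_lt.mp this).2
      linarith
    · have := hhalf _ (convex_halfSpace_im_gt 0) (fun z hz ↦ ne_of_gt hz) z h1 Complex.I
        (by simp)
      have h2 := le_max_left |(H Complex.I + c).im| |(H (-Complex.I) + c).im|
      have h3 := le_abs_self (H Complex.I + c).im
      have h4 := (abs_lt.mp this).2
      linarith
  have hb2 : ∀ z : ℂ, (H z + c).im ≤ B := by
    intro z
    by_cases hz : z.im = 0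
    · have hl : Tendsto (fun t : ℝ ↦ (H (z + t * Complex.I) + c).im) (𝓝[>] 0)
          (𝓝 (H z + c).im) := by
        have : Continuous fun t : ℝ ↦ (H (z + t * Complex.I) + c).im :=
          hcont.comp (by fun_prop : Continuous fun t : ℝ ↦ z + t * Complex.I)
        have h := this.tendsto 0
        simp only [Complex.ofReal_zero, zero_mul, add_zero] at h
        exact h.mono_left nhdsWithin_le_nhds
      refine le_of_tendsto hl ?_
      filter_upwards [self_mem_nhdsWithin] with t ht
      exact hb1 _ (by simpa [hz] using (ne_of_gt ht))
    · exact hb1 z hz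
  have hbd : Bornology.IsBounded (range fun z ↦ Complex.exp (-Complex.I * (H z + c))) := by
    refine isBounded_iff_forall_norm_le.mpr ⟨Real.exp B, ?_⟩
    rintro _ ⟨z, rfl⟩
    rw [Complex.norm_exp]
    refine Real.exp_le_exp.mpr ?_
    simpa using hb2 z
  have hdH : ∀ z, HasDerivAt (fun z ↦ Complex.exp (-Complex.I * (H z + c)))
      (Complex.exp (-Complex.I * (H z + c)) * (-Complex.I * (deriv h z / h z))) z := fun z ↦
    (((hH z).add_const c).const_mul (-Complex.I)).cexp
  have hd0 : ∀ z, deriv h z = 0 := by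
    intro z
    have h1 := Differentiable.apply_eq_apply_of_bounded
      (fun z ↦ (hdH z).differentiableAt) hbd
    have h2 : HasDerivAt (fun z ↦ Complex.exp (-Complex.I * (H z + c))) 0 z :=
      (hasDerivAt_const z (Complex.exp (-Complex.I * (H 0 + c)))).congr_of_eventuallyEq
        (Eventually.of_forall fun w ↦ h1 w 0)
    have h3 := (hdH z).unique h2
    simpa [h0 z] using h3
  exact is_const_of_deriv_eq_zero hh hd0 z w

end EntireFunctions

section WeylRatio

namespace FundSys

variable {q : ℝ → ℝ} {L : ℝ} (F : FundSys q L) (f : RatHN)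

theorem im_weyl_pos (hq : IntervalIntegrable q volume 0 L) (hL : 0 < L) {lam : ℂ}
    (hlam : 0 < lam.im) : 0 < (F.weyl f lam).im :=
  pos_of_mul_pos_left (F.im_weyl_mul_pos f hq hL hlam.ne') hlam.le

theorem deriv_charS_ne_zero (hq : IntervalIntegrable q volume 0 L) (hL : 0 < L) {lam : ℂ}
    (h : F.charS f lam = 0) : deriv (F.charS f) lam ≠ 0 := by
  obtain ⟨x, rfl⟩ : ∃ x : ℝ, (x : ℂ) = lam :=
    ⟨lam.re, Complex.ext rfl (by_contra fun hi ↦ F.charS_ne_zero f hq hL (Ne.symm hi) h)⟩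
  have hC := F.charC_ne_zero_of_charS f hq hL.le h
  have hd := ((F.differentiable_charS f x).hasDerivAt.div
    (F.differentiable_charC f x).hasDerivAt hC)
  have hg : AnalyticAt ℂ (F.charS f / F.charC f) x :=
    ((F.differentiable_charS f).analyticAt x).div ((F.differentiable_charC f).analyticAt x) hC
  have := deriv_ne_zero_of_im_pos hg (by simp [h]) fun z hz ↦ by
    have h1 := F.im_weyl_pos f hq hL hz
    have h2 : (F.charS f / F.charC f) z = -(F.weyl f z)⁻¹ := by
      rw [weyl, inv_div, div_neg, neg_neg, Pi.div_apply]
    have h3 : F.weyl f z ≠ 0 := fun h0 ↦ by simp [h0] at h1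
    rw [h2, Complex.neg_im, Complex.inv_im, ← neg_div, neg_neg]
    exact div_pos h1 (Complex.normSq_pos.mpr h3)
  intro h0
  rw [hd.deriv, h0, h] at this
  simp at this

theorem deriv_charC_ne_zero (hq : IntervalIntegrable q volume 0 L) (hL : 0 < L) {lam : ℂ}
    (h : F.charC f lam = 0) : deriv (F.charC f) lam ≠ 0 := by
  obtain ⟨x, rfl⟩ : ∃ x : ℝ, (x : ℂ) = lam :=
    ⟨lam.re, Complex.ext rfl (by_contra fun hi ↦ F.charC_ne_zero f hq hL (Ne.symm hi) h)⟩
  have hS : F.charS f x ≠ 0 := fun h' ↦ F.charC_ne_zero_of_charS f hq hL.le h' h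
  have hd := ((F.differentiable_charC f x).hasDerivAt.neg.div
    (F.differentiable_charS f x).hasDerivAt hS)
  have hg : AnalyticAt ℂ (-F.charC f / F.charS f) x :=
    ((F.differentiable_charC f).analyticAt x).neg.div ((F.differentiable_charS f).analyticAt x) hS
  have := deriv_ne_zero_of_im_pos hg (by simp [h]) fun z hz ↦ F.im_weyl_pos f hq hL hz
  intro h0
  rw [hd.deriv, Pi.neg_apply, h0, h] at this
  simp at this

end FundSys

theorem exists_weyl_eq_const_mul {q₁ q₂ : ℝ → ℝ} {L : ℝ} (hL : 0 < L)
    (hq₁ : IntervalIntegrable q₁ volume 0 L) (hq₂ : IntervalIntegrable q₂ volume 0 L)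
    (F₁ : FundSys q₁ L) (F₂ : FundSys q₂ L) (f₁ f₂ : RatHN)
    (hS : ∀ x : ℝ, F₁.charS f₁ x = 0 ↔ F₂.charS f₂ x = 0)
    (hC : ∀ x : ℝ, F₁.charC f₁ x = 0 ↔ F₂.charC f₂ x = 0) :
    ∃ c : ℂ, ∀ lam : ℂ, F₁.weyl f₁ lam = c * F₂.weyl f₂ lam := by
  have hS' : ∀ z : ℂ, F₁.charS f₁ z = 0 ↔ F₂.charS f₂ z = 0 := by
    intro z
    by_cases hz : z.im = 0
    · rw [← Complex.re_add_im z, hz]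
      simpa using hS z.re
    · simp [F₁.charS_ne_zero f₁ hq₁ hL hz, F₂.charS_ne_zero f₂ hq₂ hL hz]
  have hC' : ∀ z : ℂ, F₁.charC f₁ z = 0 ↔ F₂.charC f₂ z = 0 := by
    intro z
    by_cases hz : z.im = 0
    · rw [← Complex.re_add_im z, hz]
      simpa using hC z.re
    · simp [F₁.charC_ne_zero f₁ hq₁ hL hz, F₂.charC_ne_zero f₂ hq₂ hL hz]
  obtain ⟨E, hE, hE0, hES⟩ := exists_entire_quotient (F₁.differentiable_charS f₁)
    (F₂.differentiable_charS f₂) hS' (fun _ ↦ F₁.deriv_charS_ne_zero f₁ hq₁ hL)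
    (fun _ ↦ F₂.deriv_charS_ne_zero f₂ hq₂ hL)
  obtain ⟨G, hG, hG0, hGC⟩ := exists_entire_quotient (F₁.differentiable_charC f₁)
    (F₂.differentiable_charC f₂) hC' (fun _ ↦ F₁.deriv_charC_ne_zero f₁ hq₁ hL)
    (fun _ ↦ F₂.deriv_charC_ne_zero f₂ hq₂ hL)
  have hM : ∀ z : ℂ, F₁.weyl f₁ z = G z / E z * F₂.weyl f₂ z := by
    intro z
    rw [FundSys.weyl, FundSys.weyl, hES, hGC, ← mul_neg, mul_div_mul_comm]
  have hconst := eq_const_of_mem_slitPlane (h := fun z ↦ G z / E z) (hG.div hE hE0)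
    (fun z ↦ div_ne_zero (hG0 z) (hE0 z)) fun z hz ↦ by
      have h1 := F₁.im_weyl_mul_pos f₁ hq₁ hL hz
      have h2 := F₂.im_weyl_mul_pos f₂ hq₂ hL hz
      rw [Complex.mem_slitPlane_iff, or_iff_not_imp_right, not_not]
      intro him
      rw [hM z, Complex.mul_im, him, zero_mul, add_zero, mul_assoc] at h1
      exact pos_of_mul_pos_left h1 h2.le
  exact ⟨G 0 / E 0, fun z ↦ by rw [hM z, hconst z 0]⟩

end WeylRatio

section Asymptotics

namespace IsSol

variable {q : ℝ → ℝ} {L : ℝ} {k : ℂ} {y v : ℝ → ℂ}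

theorem sub_mul_exp_eq (h : IsSol q L (k ^ 2) y v) (hq : IntervalIntegrable q volume 0 L) {t : ℝ}
    (ht : t ∈ Icc 0 L) :
    (v t - Complex.I * k * y t) * Complex.exp (Complex.I * k * t)
      = (v 0 - Complex.I * k * y 0)
        + ∫ u in (0:ℝ)..t, (q u : ℂ) * (y u * Complex.exp (Complex.I * k * u)) := by
  have hL : 0 ≤ L := ht.1.trans ht.2
  have hsub : ∀ t ∈ Icc 0 L, uIcc 0 t ⊆ uIcc 0 L := fun t ht ↦ by
    rw [uIcc_of_le hL, uIcc_of_le ht.1]; exact Icc_subset_Icc le_rfl ht.2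
  have i1 := h.intervalIntegrable_deriv hL
  have i2 := h.intervalIntegrable_coeff hL hq
  have hd : ∀ t : ℝ, HasDerivAt (fun t : ℝ ↦ Complex.exp (Complex.I * k * t))
      (Complex.I * k * Complex.exp (Complex.I * k * t)) t := by
    intro t
    have h1 : HasDerivAt (fun t : ℝ ↦ Complex.I * k * (t : ℂ)) (Complex.I * k) t := by
      simpa using (Complex.ofRealCLM.hasDerivAt (x := t)).const_mul (Complex.I * k)
    convert! h1.cexp using 1
    ring
  have hce : Continuous fun t : ℝ ↦ Complex.I * k * Complex.exp (Complex.I * k * t) := by fun_prop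
  have e := mul_eq_add_integral (L := L) (F := fun t ↦ v t - Complex.I * k * y t)
    (G := fun t : ℝ ↦ Complex.exp (Complex.I * k * t)) (i2.sub (i1.const_mul (Complex.I * k)))
    (hce.intervalIntegrable 0 L) (fun s hs ↦ by
      rw [intervalIntegral.integral_sub (i2.mono_set (hsub s hs))
        ((i1.mono_set (hsub s hs)).const_mul _), intervalIntegral.integral_const_mul,
        h.eq_integral s hs, h.deriv_eq_integral s hs]
      ring) (fun s hs ↦ by
      rw [intervalIntegral.integral_eq_sub_of_hasDerivAt (fun u _ ↦ hd u)
        (hce.intervalIntegrable 0 s)]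
      simp) ht
  refine e.trans ?_
  simp only [Complex.ofReal_zero, mul_zero, Complex.exp_zero, mul_one]
  congr 1
  apply intervalIntegral.integral_congr
  intro u _
  simp only
  linear_combination (-k ^ 2 * y u * Complex.exp (Complex.I * k * u)) * Complex.I_sq

theorem norm_exp_I_mul (k : ℂ) (t : ℝ) :
    ‖Complex.exp (Complex.I * k * t)‖ = Real.exp (-(k.im * t)) := by
  rw [Complex.norm_exp]
  simp

/-- The Volterra remainder terms are bounded by the supremum of `y exp (i k t)`. -/
theorem norm_remainder_le (h : IsSol q L (k ^ 2) y v) (hq : IntervalIntegrable q volume 0 L)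
    (hk : 0 ≤ k.im) {Z : ℝ} (hZ0 : 0 ≤ Z)
    (hZ : ∀ u ∈ Icc 0 L, ‖y u * Complex.exp (Complex.I * k * u)‖ ≤ Z) {t : ℝ} (ht : t ∈ Icc 0 L) :
    ‖2 * Complex.I * k * y t * Complex.exp (Complex.I * k * t)
      - (Complex.exp (Complex.I * k * t) ^ 2 * (v 0 + Complex.I * k * y 0)
        - (v 0 - Complex.I * k * y 0))‖ ≤ 2 * ((∫ u in (0:ℝ)..L, |q u|) * Z) ∧
    ‖2 * v t * Complex.exp (Complex.I * k * t)
      - (Complex.exp (Complex.I * k * t) ^ 2 * (v 0 + Complex.I * k * y 0)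
        + (v 0 - Complex.I * k * y 0))‖ ≤ 2 * ((∫ u in (0:ℝ)..L, |q u|) * Z) := by
  have hL : 0 ≤ L := ht.1.trans ht.2
  have hsub : uIcc 0 t ⊆ uIcc 0 L := by
    rw [uIcc_of_le hL, uIcc_of_le ht.1]; exact Icc_subset_Icc le_rfl ht.2
  have e1 := h.sub_mul_exp_eq hq ht
  have h' : IsSol q L ((-k) ^ 2) y v := by rwa [neg_sq]
  have e2 := h'.sub_mul_exp_eq hq ht
  have hEE : Complex.exp (Complex.I * -k * t) * Complex.exp (Complex.I * k * t) = 1 := by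
    rw [← Complex.exp_add]
    ring_nf
    simp
  set E := Complex.exp (Complex.I * k * t) with hE
  set I1 := ∫ u in (0:ℝ)..t, (q u : ℂ) * (y u * Complex.exp (Complex.I * k * u)) with hI1
  set I2 := ∫ u in (0:ℝ)..t, (q u : ℂ) * (y u * Complex.exp (Complex.I * -k * u)) with hI2
  have hbound : ∀ {g : ℝ → ℂ}, (∀ u ∈ Icc 0 t, ‖g u‖ ≤ |q u| * Z) →
      ‖∫ u in (0:ℝ)..t, g u‖ ≤ (∫ u in (0:ℝ)..L, |q u|) * Z := by
    intro g hg
    refine (intervalIntegral.norm_integral_le_of_norm_le ht.1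
      (Eventually.of_forall fun u hu ↦ hg u ⟨hu.1.le, hu.2⟩)
      ((hq.abs.mono_set hsub).mul_const Z)).trans ?_
    rw [intervalIntegral.integral_mul_const]
    gcongr
    exact intervalIntegral.integral_mono_interval le_rfl ht.1 ht.2
      (Eventually.of_forall fun _ ↦ abs_nonneg _) hq.abs
  have b1 : ‖I1‖ ≤ (∫ u in (0:ℝ)..L, |q u|) * Z := by
    refine hbound fun u hu ↦ ?_
    rw [norm_mul, Complex.norm_real, Real.norm_eq_abs]
    gcongr
    exact hZ u ⟨hu.1, hu.2.trans ht.2⟩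
  have b2 : ‖E ^ 2 * I2‖ ≤ (∫ u in (0:ℝ)..L, |q u|) * Z := by
    rw [hI2, ← intervalIntegral.integral_const_mul]
    refine hbound fun u hu ↦ ?_
    have e3 : E ^ 2 * ((q u : ℂ) * (y u * Complex.exp (Complex.I * -k * u)))
        = (q u : ℂ) * ((y u * Complex.exp (Complex.I * k * u))
          * Complex.exp (Complex.I * k * ((t - u : ℝ) : ℂ)) ^ 2) := by
      have : E * Complex.exp (Complex.I * -k * u)
          = Complex.exp (Complex.I * k * ((t - u : ℝ) : ℂ)) := by
        rw [hE, ← Complex.exp_add]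
        push_cast
        ring_nf
      have h4 : Complex.exp (Complex.I * k * u) * Complex.exp (Complex.I * k * ((t - u : ℝ) : ℂ))
          = E := by
        rw [hE, ← Complex.exp_add]
        push_cast
        ring_nf
      linear_combination (q u : ℂ) * y u * E * this
        - (q u : ℂ) * y u * Complex.exp (Complex.I * k * ((t - u : ℝ) : ℂ)) * h4
    rw [e3, norm_mul, Complex.norm_real, Real.norm_eq_abs]
    gcongr
    rw [norm_mul, norm_pow, norm_exp_I_mul]
    have h5 := hZ u ⟨hu.1, hu.2.trans ht.2⟩
    have h6 : Real.exp (-(k.im * (t - u))) ≤ 1 := by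
      rw [Real.exp_le_one_iff]
      have := mul_nonneg hk (sub_nonneg.mpr hu.2)
      linarith
    exact (mul_le_of_le_one_right (norm_nonneg _) (pow_le_one₀ (Real.exp_pos _).le h6)).trans h5
  have e2' : (v t + Complex.I * k * y t) * E = E ^ 2 * ((v 0 + Complex.I * k * y 0) + I2) := by
    linear_combination E ^ 2 * e2 - (v t + Complex.I * k * y t) * E * hEE
  constructor
  · have : 2 * Complex.I * k * y t * E - (E ^ 2 * (v 0 + Complex.I * k * y 0)
        - (v 0 - Complex.I * k * y 0)) = E ^ 2 * I2 - I1 := by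
      linear_combination e2' - e1
    rw [this]
    exact (norm_sub_le _ _).trans (by linarith)
  · have : 2 * v t * E - (E ^ 2 * (v 0 + Complex.I * k * y 0)
        + (v 0 - Complex.I * k * y 0)) = E ^ 2 * I2 + I1 := by
      linear_combination e2' + e1
    rw [this]
    exact (norm_add_le _ _).trans (by linarith)

theorem norm_mul_exp_le (h : IsSol q L (k ^ 2) y v) (hq : IntervalIntegrable q volume 0 L)
    (hk : 0 ≤ k.im) (hkq : 2 * ∫ u in (0:ℝ)..L, |q u| ≤ ‖k‖) {t : ℝ} (ht : t ∈ Icc 0 L) :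
    ‖k‖ * ‖y t * Complex.exp (Complex.I * k * t)‖
      ≤ ‖v 0 + Complex.I * k * y 0‖ + ‖v 0 - Complex.I * k * y 0‖ := by
  have hc : ContinuousOn (fun t : ℝ ↦ ‖y t * Complex.exp (Complex.I * k * t)‖) (Icc 0 L) :=
    (h.cont.mul (by fun_prop)).norm
  obtain ⟨s, hs, hmax⟩ := isCompact_Icc.exists_isMaxOn ⟨t, ht⟩ hc
  set Z := ‖y s * Complex.exp (Complex.I * k * s)‖ with hZ
  have h1 := (h.norm_remainder_le hq hk (norm_nonneg _) (fun u hu ↦ hmax hu) hs).1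
  have h2 : ‖2 * Complex.I * k * y s * Complex.exp (Complex.I * k * s)‖ = 2 * ‖k‖ * Z := by
    rw [hZ, mul_assoc, norm_mul]
    simp
  have h3 : ‖Complex.exp (Complex.I * k * s) ^ 2 * (v 0 + Complex.I * k * y 0)
        - (v 0 - Complex.I * k * y 0)‖
      ≤ ‖v 0 + Complex.I * k * y 0‖ + ‖v 0 - Complex.I * k * y 0‖ := by
    refine (norm_sub_le _ _).trans (add_le_add_left ?_ _)
    rw [norm_mul, norm_pow, norm_exp_I_mul]
    refine mul_le_of_le_one_left (norm_nonneg _) (pow_le_one₀ (Real.exp_pos _).le ?_)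
    rw [Real.exp_le_one_iff]
    have := mul_nonneg hk hs.1
    linarith
  have h4 := norm_le_insert' (2 * Complex.I * k * y s * Complex.exp (Complex.I * k * s))
    (Complex.exp (Complex.I * k * s) ^ 2 * (v 0 + Complex.I * k * y 0)
        - (v 0 - Complex.I * k * y 0))
  rw [h2] at h4
  have h5 : 2 * ((∫ u in (0:ℝ)..L, |q u|) * Z) ≤ ‖k‖ * Z := by
    have := mul_le_mul_of_nonneg_right hkq (norm_nonneg (y s * Complex.exp (Complex.I * k * s)))
    linarith
  have h6 : ‖k‖ * ‖y t * Complex.exp (Complex.I * k * t)‖ ≤ ‖k‖ * Z :=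
    mul_le_mul_of_nonneg_left (hmax ht) (norm_nonneg _)
  change _ ≤ 2 * ((∫ u in (0:ℝ)..L, |q u|) * Z) at h1
  linarith

end IsSol

namespace FundSys

variable {q : ℝ → ℝ} {L : ℝ} (F : FundSys q L)

theorem norm_S_le (hq : IntervalIntegrable q volume 0 L) {k : ℂ} (hk : 0 ≤ k.im)
    (hkq : 2 * ∫ u in (0:ℝ)..L, |q u| ≤ ‖k‖) {t : ℝ} (ht : t ∈ Icc 0 L) :
    ‖k‖ * ‖F.S (k ^ 2) t * Complex.exp (Complex.I * k * t)‖ ≤ 2 := by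
  have := (F.hS (k ^ 2)).norm_mul_exp_le hq hk hkq ht
  simp only [F.S_zero, F.S'_zero, mul_zero, add_zero, sub_zero, norm_one] at this
  linarith

theorem norm_C_le (hq : IntervalIntegrable q volume 0 L) {k : ℂ} (hk : 0 ≤ k.im) (hk0 : k ≠ 0)
    (hkq : 2 * ∫ u in (0:ℝ)..L, |q u| ≤ ‖k‖) {t : ℝ} (ht : t ∈ Icc 0 L) :
    ‖F.C (k ^ 2) t * Complex.exp (Complex.I * k * t)‖ ≤ 2 := by
  have := (F.hC (k ^ 2)).norm_mul_exp_le hq hk hkq ht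
  simp only [F.C_zero, F.C'_zero, mul_one, zero_add, zero_sub, norm_neg, norm_mul, Complex.norm_I,
    one_mul] at this
  have h0 : 0 < ‖k‖ := norm_pos_iff.mpr hk0
  rw [norm_mul]
  refine le_of_mul_le_mul_left ?_ h0
  linarith

section Limits

variable {l : Filter ℂ}

theorem tendsto_norm_atTop_of_im (hl : Tendsto Complex.im l atTop) :
    Tendsto (fun k : ℂ ↦ ‖k‖) l atTop :=
  tendsto_atTop_mono (fun k ↦ (le_abs_self _).trans (Complex.abs_im_le_norm k)) hl

theorem tendsto_exp_zero (hl : Tendsto Complex.im l atTop)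
    {t : ℝ} (ht : 0 < t) :
    Tendsto (fun k : ℂ ↦ Complex.exp (Complex.I * k * t)) l (𝓝 0) := by
  rw [tendsto_zero_iff_norm_tendsto_zero]
  simp only [IsSol.norm_exp_I_mul]
  exact Real.tendsto_exp_neg_atTop_nhds_zero.comp (hl.atTop_mul_const ht)

theorem eventually_large (hl : Tendsto Complex.im l atTop)
    (q : ℝ → ℝ) (L : ℝ) :
    ∀ᶠ k in l, 0 ≤ k.im ∧ k ≠ 0 ∧ 2 * ∫ u in (0:ℝ)..L, |q u| ≤ ‖k‖ := by
  filter_upwards [hl.eventually_gt_atTop 0,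
    (tendsto_norm_atTop_of_im hl).eventually_ge_atTop (2 * ∫ u in (0:ℝ)..L, |q u|)] with k h1 h2
  exact ⟨h1.le, fun h ↦ by simp [h] at h1, h2⟩

theorem tendsto_const_div_norm (hl : Tendsto Complex.im l atTop)
    (c : ℝ) : Tendsto (fun k : ℂ ↦ c / ‖k‖) l (𝓝 0) :=
  (tendsto_norm_atTop_of_im hl).const_div_atTop c

theorem tendsto_S (hl : Tendsto Complex.im l atTop)
    (hq : IntervalIntegrable q volume 0 L) {t : ℝ} (ht : t ∈ Icc 0 L) (ht0 : 0 < t) :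
    Tendsto (fun k : ℂ ↦ k * F.S (k ^ 2) t * Complex.exp (Complex.I * k * t)) l
      (𝓝 (Complex.I / 2)) := by
  have h1 : Tendsto (fun k : ℂ ↦ 2 * Complex.I * k * F.S (k ^ 2) t * Complex.exp (Complex.I * k * t)
      - (Complex.exp (Complex.I * k * t) ^ 2 - 1)) l (𝓝 0) := by
    refine squeeze_zero_norm' ?_
      (tendsto_const_div_norm hl (2 * ((∫ u in (0:ℝ)..L, |q u|) * 2)))
    filter_upwards [eventually_large hl q L] with k ⟨hk1, hk0, hk2⟩
    have hk : 0 < ‖k‖ := norm_pos_iff.mpr hk0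
    have := ((F.hS (k ^ 2)).norm_remainder_le hq hk1 (Z := 2 / ‖k‖) (by positivity)
      (fun u hu ↦ by
        rw [le_div_iff₀ hk, mul_comm]; exact F.norm_S_le hq hk1 hk2 hu) ht).1
    simp only [F.S_zero, F.S'_zero, mul_zero, add_zero, sub_zero, mul_one] at this
    refine this.trans_eq ?_
    ring
  have h2 := (h1.add (((tendsto_exp_zero hl ht0).pow 2).sub_const 1)).const_mul (-Complex.I / 2)
  convert! h2 using 2 with k
  · linear_combination (k * F.S (k ^ 2) t * Complex.exp (Complex.I * k * t)) * Complex.I_sq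
  · ring

theorem tendsto_S' (hl : Tendsto Complex.im l atTop)
    (hq : IntervalIntegrable q volume 0 L) {t : ℝ} (ht : t ∈ Icc 0 L)
    (ht0 : 0 < t) :
    Tendsto (fun k : ℂ ↦ F.S' (k ^ 2) t * Complex.exp (Complex.I * k * t)) l (𝓝 (1 / 2)) := by
  have h1 : Tendsto (fun k : ℂ ↦ 2 * F.S' (k ^ 2) t * Complex.exp (Complex.I * k * t)
      - (Complex.exp (Complex.I * k * t) ^ 2 + 1)) l (𝓝 0) := by
    refine squeeze_zero_norm' ?_
      (tendsto_const_div_norm hl (2 * ((∫ u in (0:ℝ)..L, |q u|) * 2)))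
    filter_upwards [eventually_large hl q L] with k ⟨hk1, hk0, hk2⟩
    have hk : 0 < ‖k‖ := norm_pos_iff.mpr hk0
    have := ((F.hS (k ^ 2)).norm_remainder_le hq hk1 (Z := 2 / ‖k‖) (by positivity)
      (fun u hu ↦ by
        rw [le_div_iff₀ hk, mul_comm]; exact F.norm_S_le hq hk1 hk2 hu) ht).2
    simp only [F.S_zero, F.S'_zero, mul_zero, add_zero, sub_zero, mul_one] at this
    refine this.trans_eq ?_
    ring
  have h2 := (h1.add (((tendsto_exp_zero hl ht0).pow 2).add_const 1)).const_mul (1 / 2)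
  convert! h2 using 2 with k
  · ring
  · ring

theorem tendsto_C (hl : Tendsto Complex.im l atTop)
    (hq : IntervalIntegrable q volume 0 L) {t : ℝ} (ht : t ∈ Icc 0 L) (ht0 : 0 < t) :
    Tendsto (fun k : ℂ ↦ F.C (k ^ 2) t * Complex.exp (Complex.I * k * t)) l (𝓝 (1 / 2)) := by
  have h1 : Tendsto (fun k : ℂ ↦ 2 * F.C (k ^ 2) t * Complex.exp (Complex.I * k * t)
      - (Complex.exp (Complex.I * k * t) ^ 2 + 1)) l (𝓝 0) := by
    refine squeeze_zero_norm' ?_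
      (tendsto_const_div_norm hl (2 * ((∫ u in (0:ℝ)..L, |q u|) * 2)))
    filter_upwards [eventually_large hl q L] with k ⟨hk1, hk0, hk2⟩
    have hk : 0 < ‖k‖ := norm_pos_iff.mpr hk0
    have := ((F.hC (k ^ 2)).norm_remainder_le hq hk1 (Z := 2) (by positivity)
      (fun u hu ↦ F.norm_C_le hq hk1 hk0 hk2 hu) ht).1
    simp only [F.C_zero, F.C'_zero, mul_one, zero_add, zero_sub] at this
    rw [le_div_iff₀ hk]
    refine le_trans (le_of_eq ?_) this
    have h3 : ‖Complex.I * k‖ = ‖k‖ := by simp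
    rw [← h3, ← norm_mul]
    congr 1
    ring
  have h2 := (h1.add (((tendsto_exp_zero hl ht0).pow 2).add_const 1)).const_mul (1 / 2)
  convert! h2 using 2 with k
  · ring
  · ring

end Limits

end FundSys

end Asymptotics

section Diagonal

open scoped ComplexConjugate

/-- If two solutions have Wronskian `1` and Herglotz quotients of opposite signs, their product is
controlled by the imaginary part of one of the quotients. -/
theorem norm_mul_mul_abs_im_div_le {s s' p p' : ℂ} {m : ℝ} (hw : p * s' - p' * s = 1)
    (hs : (conj s * s').im * m < 0) (hp : 0 ≤ (conj p * p').im * m) :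
    ‖p * s‖ * |(s' / s).im| ≤ 1 := by
  have hs0 : s ≠ 0 := by
    rintro rfl
    simp at hs
  by_cases h0 : p * s = 0
  · simp [h0]
  have hn : 0 < ‖p * s‖ := norm_pos_iff.mpr h0
  have hA : (conj s * s').im = ‖s‖ ^ 2 * (s' / s).im := by
    have h1 : conj s * s' = ((‖s‖ ^ 2 : ℝ) : ℂ) * (s' / s) := by
      push_cast
      rw [← Complex.conj_mul' s]
      field_simp
    rw [h1, Complex.im_ofReal_mul]
  have e : -(p * s).im = ‖p‖ ^ 2 * (conj s * s').im - ‖s‖ ^ 2 * (conj p * p').im := by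
    have h1 : conj (p * s) = ((‖p‖ ^ 2 : ℝ) : ℂ) * (conj s * s')
        - ((‖s‖ ^ 2 : ℝ) : ℂ) * (conj p * p') := by
      push_cast
      rw [← Complex.conj_mul' s, ← Complex.conj_mul' p, map_mul]
      linear_combination (-conj p * conj s) * hw
    have := congrArg Complex.im h1
    rwa [Complex.conj_im, Complex.sub_im, Complex.im_ofReal_mul, Complex.im_ofReal_mul] at this
  have hm : m ≠ 0 := by
    rintro rfl
    simp at hs
  have h2 : ‖p * s‖ ^ 2 * |(s' / s).im| * |m| ≤ ‖p * s‖ * |m| := by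
    have h3 : ‖p * s‖ ^ 2 * |(s' / s).im| * |m| = -(‖p‖ ^ 2 * ((conj s * s').im * m)) := by
      rw [mul_assoc, ← abs_mul, norm_mul, mul_pow, mul_assoc,
        ← abs_of_pos (pow_pos (norm_pos_iff.mpr hs0) 2), ← abs_mul, ← mul_assoc (‖s‖ ^ 2), ← hA,
        abs_of_neg hs]
      ring
    have h4 : ‖p * s‖ * |m| ≥ (p * s).im * m := by
      refine (le_abs_self _).trans ?_
      rw [abs_mul]
      gcongr
      exact Complex.abs_im_le_norm _
    have h5 : (p * s).im * m = -(‖p‖ ^ 2 * ((conj s * s').im * m))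
        + ‖s‖ ^ 2 * ((conj p * p').im * m) := by
      linear_combination (-m) * e
    have h6 : 0 ≤ ‖s‖ ^ 2 * ((conj p * p').im * m) := by positivity
    linarith
  have h3 := le_of_mul_le_mul_right h2 (abs_pos.mpr hm)
  rw [pow_two, mul_assoc] at h3
  exact (mul_le_iff_le_one_right hn).mp h3

namespace FundSys

variable {q : ℝ → ℝ} {L : ℝ} (F : FundSys q L) (f : RatHN)

theorem norm_weylSol_mul_S_le (hq : IntervalIntegrable q volume 0 L) {lam : ℂ}
    (hlam : lam.im ≠ 0) {t : ℝ} (ht : t ∈ Icc 0 L) (ht0 : 0 < t) :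
    ‖F.weylSol f lam t * F.S lam t‖ * |(F.S' lam t / F.S lam t).im| ≤ 1 := by
  have hL : 0 < L := ht0.trans_le ht.2
  refine norm_mul_mul_abs_im_div_le ?_ (F.im_S_mul_neg hq hlam ht ht0)
    (F.im_weylSol_nonneg f hq hL hlam ht)
  rw [(F.isSol_weylSol f hq lam).wronskian (F.hS lam) hq ht, F.weylSol_zero, F.S_zero, F.S'_zero]
  ring

section Limits

variable {l : Filter ℂ}

theorem tendsto_div (hl : Tendsto Complex.im l atTop)
    (hq : IntervalIntegrable q volume 0 L) {t : ℝ}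
    (ht : t ∈ Icc 0 L) (ht0 : 0 < t) :
    Tendsto (fun k : ℂ ↦ (F.S' (k ^ 2) t * Complex.exp (Complex.I * k * t))
      / (k * F.S (k ^ 2) t * Complex.exp (Complex.I * k * t))) l (𝓝 (-Complex.I)) := by
  convert! (F.tendsto_S' hl hq ht ht0).div (F.tendsto_S hl hq ht ht0) (by simp) using 2
  field_simp
  simp

theorem eventually_im_sq_ne_zero (hl : Tendsto Complex.im l atTop)
    (hd : ∀ᶠ k : ℂ in l, |k.re| = k.im) : ∀ᶠ k : ℂ in l, (k ^ 2).im ≠ 0 := by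
  filter_upwards [hd, hl.eventually_gt_atTop 0] with k h1 h2
  have h3 : (k ^ 2).im = 2 * (k.re * k.im) := by
    rw [pow_two, Complex.mul_im]
    ring
  rw [h3]
  have h4 : k.re ≠ 0 := by
    intro h
    simp [h] at h1
    linarith
  have := h2.ne'
  positivity

theorem tendsto_weylSol_mul_S (hl : Tendsto Complex.im l atTop) (hd : ∀ᶠ k : ℂ in l, |k.re| = k.im)
    (hq : IntervalIntegrable q volume 0 L) {t : ℝ}
    (ht : t ∈ Icc 0 L) (ht0 : 0 < t) :
    Tendsto (fun k : ℂ ↦ F.weylSol f (k ^ 2) t * F.S (k ^ 2) t) l (𝓝 0) := by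
  set r : ℂ → ℂ := fun k ↦ (F.S' (k ^ 2) t * Complex.exp (Complex.I * k * t))
      / (k * F.S (k ^ 2) t * Complex.exp (Complex.I * k * t)) with hr
  have h1 : Tendsto r l (𝓝 (-Complex.I)) := F.tendsto_div hl hq ht ht0
  have h2 : Tendsto (fun k ↦ |(r k).im| - |(r k).re|) l (𝓝 1) := by
    have h3 := ((Complex.continuous_im.tendsto _).comp h1).abs
    have h4 := ((Complex.continuous_re.tendsto _).comp h1).abs
    simpa using h3.sub h4
  have h3 : Tendsto (fun k : ℂ ↦ k.im * (|(r k).im| - |(r k).re|)) l atTop :=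
    hl.atTop_mul_pos one_pos h2
  have h4 : Tendsto (fun k : ℂ ↦ 1 / (k.im * (|(r k).im| - |(r k).re|))) l (𝓝 0) :=
    h3.const_div_atTop 1
  refine squeeze_zero_norm' ?_ h4
  filter_upwards [h3.eventually_gt_atTop 0, hd, eventually_im_sq_ne_zero hl hd,
    hl.eventually_gt_atTop 0] with k h5 h6 h7 h8
  rw [le_div_iff₀ h5]
  refine le_trans ?_ (F.norm_weylSol_mul_S_le f hq h7 ht ht0)
  gcongr
  have hk0 : k ≠ 0 := by
    rintro rfl
    simp at h8
  have h9 : F.S' (k ^ 2) t / F.S (k ^ 2) t = k * r k := by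
    have := F.S_ne_zero hq h7 ht ht0
    have := Complex.exp_ne_zero (Complex.I * k * t)
    simp only [hr]
    field_simp
  rw [h9, Complex.mul_im]
  have h10 := abs_sub_abs_le_abs_sub (k.re * (r k).im) (-(k.im * (r k).re))
  rw [abs_neg, abs_mul, abs_mul, h6, abs_of_pos h8, sub_neg_eq_add] at h10
  linarith

theorem tendsto_mul_exp_sq (hl : Tendsto Complex.im l atTop) (hd : ∀ᶠ k : ℂ in l, |k.re| = k.im)
    {t : ℝ} (ht0 : 0 < t) :
    Tendsto (fun k : ℂ ↦ k * Complex.exp (Complex.I * k * t) ^ 2) l (𝓝 0) := by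
  have h1 : Tendsto (fun x : ℝ ↦ 2 * (x * Real.exp (-(x * t)) ^ 2)) atTop (𝓝 0) := by
    have h2 := (Real.tendsto_pow_mul_exp_neg_atTop_nhds_zero 1).comp
      (tendsto_id.atTop_mul_const (show 0 < 2 * t by positivity))
    have h3 := h2.const_mul (1 / t)
    rw [mul_zero] at h3
    refine h3.congr fun x ↦ ?_
    simp only [Function.comp, id, pow_one]
    rw [← Real.exp_nat_mul]
    field_simp
    ring_nf
  refine squeeze_zero_norm' ?_ (h1.comp hl)
  filter_upwards [hd, hl.eventually_gt_atTop 0] with k h5 h6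
  rw [norm_mul, norm_pow, IsSol.norm_exp_I_mul]
  have h7 := Complex.norm_le_abs_re_add_abs_im k
  rw [h5, abs_of_pos h6] at h7
  simp only [Function.comp]
  rw [← mul_assoc]
  gcongr
  linarith

theorem tendsto_weyl_div (hl : Tendsto Complex.im l atTop) (hd : ∀ᶠ k : ℂ in l, |k.re| = k.im)
    (hq : IntervalIntegrable q volume 0 L) (hL : 0 < L) :
    Tendsto (fun k : ℂ ↦ F.weyl f (k ^ 2) / k) l (𝓝 Complex.I) := by
  have ht : L ∈ Icc 0 L := ⟨hL.le, le_rfl⟩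
  have hS := F.tendsto_S hl hq ht hL
  have h1 := ((F.tendsto_weylSol_mul_S f hl hd hq ht hL).mul (tendsto_mul_exp_sq hl hd hL)).div
    (hS.pow 2) (by simp)
  have h2 := h1.sub ((F.tendsto_C hl hq ht hL).div hS (by simp))
  have h3 : 0 * 0 / (Complex.I / 2) ^ 2 - 1 / 2 / (Complex.I / 2) = Complex.I := by
    field_simp
    simp
  rw [h3] at h2
  refine h2.congr' ?_
  filter_upwards [eventually_im_sq_ne_zero hl hd, hl.eventually_gt_atTop 0] with k h7 h8
  have hk0 : k ≠ 0 := by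
    rintro rfl
    simp at h8
  have := F.S_ne_zero hq h7 ht hL
  have := Complex.exp_ne_zero (Complex.I * k * L)
  simp only [Pi.div_apply, weylSol]
  field_simp
  ring

end Limits

end FundSys

/-- The filter of points tending to infinity along the two diagonals in the upper half plane. -/
def upperDiagonals : Filter ℂ := comap Complex.im atTop ⊓ 𝓟 {k : ℂ | |k.re| = k.im}

theorem tendsto_im_upperDiagonals : Tendsto Complex.im upperDiagonals atTop :=
  tendsto_comap.mono_left inf_le_left

theorem eventually_upperDiagonals : ∀ᶠ k in upperDiagonals, |k.re| = k.im :=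
  mem_inf_of_right (mem_principal_self _)

theorem tendsto_upperDiagonals {w : ℂ} (hw : w.im = 1) (hw' : |w.re| = 1) :
    Tendsto (fun x : ℝ ↦ (x : ℂ) * w) atTop upperDiagonals := by
  refine tendsto_inf.mpr ⟨tendsto_comap_iff.mpr ?_, tendsto_principal.mpr ?_⟩
  · exact tendsto_id.congr fun x ↦ by simp [hw]
  · filter_upwards [eventually_ge_atTop 0] with x hx
    simp [abs_mul, hw, hw', abs_of_nonneg hx]

instance : upperDiagonals.NeBot :=
  (tendsto_upperDiagonals (w := 1 + Complex.I) (by simp) (by simp)).neBot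

section Pair

variable {q₁ q₂ : ℝ → ℝ} {L : ℝ} (F₁ : FundSys q₁ L) (F₂ : FundSys q₂ L) (f₁ f₂ : RatHN)

theorem weyl_eq_of_eq_const_mul (hL : 0 < L) (hq₁ : IntervalIntegrable q₁ volume 0 L)
    (hq₂ : IntervalIntegrable q₂ volume 0 L) {c : ℂ}
    (h : ∀ lam, F₁.weyl f₁ lam = c * F₂.weyl f₂ lam) (lam : ℂ) :
    F₁.weyl f₁ lam = F₂.weyl f₂ lam := by
  have h1 := F₁.tendsto_weyl_div f₁ tendsto_im_upperDiagonals eventually_upperDiagonals hq₁ hL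
  have h2 := (F₂.tendsto_weyl_div f₂ tendsto_im_upperDiagonals eventually_upperDiagonals hq₂
    hL).const_mul c
  have h3 := tendsto_nhds_unique h1 (h2.congr fun k ↦ by rw [h, mul_div_assoc])
  have hc : c = 1 := mul_right_cancel₀ Complex.I_ne_zero (by rw [← h3, one_mul])
  rw [h, hc, one_mul]

theorem tendsto_cross (hq₁ : IntervalIntegrable q₁ volume 0 L)
    (hq₂ : IntervalIntegrable q₂ volume 0 L) (h : ∀ lam, F₁.weyl f₁ lam = F₂.weyl f₂ lam)
    {t : ℝ} (ht : t ∈ Icc 0 L) (ht0 : 0 < t) :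
    Tendsto (fun k : ℂ ↦ F₁.S (k ^ 2) t * F₂.C (k ^ 2) t - F₂.S (k ^ 2) t * F₁.C (k ^ 2) t)
      upperDiagonals (𝓝 0) := by
  have hl := tendsto_im_upperDiagonals
  have hd := eventually_upperDiagonals
  have hS₁ := F₁.tendsto_S hl hq₁ ht ht0
  have hS₂ := F₂.tendsto_S hl hq₂ ht ht0
  have h1 := ((hS₁.div hS₂ (by simp)).mul (F₂.tendsto_weylSol_mul_S f₂ hl hd hq₂ ht ht0)).sub
    ((hS₂.div hS₁ (by simp)).mul (F₁.tendsto_weylSol_mul_S f₁ hl hd hq₁ ht ht0))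
  simp only [mul_zero, sub_zero] at h1
  refine h1.congr' ?_
  filter_upwards [FundSys.eventually_im_sq_ne_zero hl hd, hl.eventually_gt_atTop 0] with k h7 h8
  have hk0 : k ≠ 0 := by
    rintro rfl
    simp at h8
  have := F₁.S_ne_zero hq₁ h7 ht ht0
  have := F₂.S_ne_zero hq₂ h7 ht ht0
  have := Complex.exp_ne_zero (Complex.I * k * t)
  simp only [Pi.div_apply, FundSys.weylSol, h]
  field_simp
  ring

end Pair

end Diagonal

section Vanishing

theorem exists_norm_le_of_tendsto_atTop {g : ℝ → ℂ} {a : ℂ} (hg : Continuous g)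
    (h : Tendsto g atTop (𝓝 a)) : ∃ C, ∀ x, 0 ≤ x → ‖g x‖ ≤ C := by
  obtain ⟨R, hR⟩ := eventually_atTop.mp
    (h.norm.eventually_le_const (show ‖a‖ < ‖a‖ + 1 by linarith))
  obtain ⟨C, hC⟩ := isCompact_Icc.exists_bound_of_continuousOn (s := Icc 0 R) hg.continuousOn
  refine ⟨max C (‖a‖ + 1), fun x hx ↦ ?_⟩
  rcases le_total x R with hxR | hxR
  · exact (hC x ⟨hx, hxR⟩).trans (le_max_left _ _)
  · exact (hR x hxR).trans (le_max_right _ _)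

/-- An entire function of order at most `1/2` tending to zero along the images of the two upper
diagonals under squaring vanishes identically. -/
theorem eq_zero_of_tendsto_upperDiagonals {H : ℂ → ℂ} (hH : Differentiable ℂ H) {R A B : ℝ}
    (hB : ∀ k : ℂ, 0 ≤ k.im → R ≤ ‖k‖ → ‖H (k ^ 2)‖ ≤ A * Real.exp (B * ‖k‖))
    (h0 : Tendsto (fun k : ℂ ↦ H (k ^ 2)) upperDiagonals (𝓝 0)) (z : ℂ) : H z = 0 := by
  set w : ℂ := 1 + Complex.I with hw
  have hw0 : w ≠ 0 := fun h ↦ by simpa [hw] using congrArg Complex.im h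
  set G : ℂ → ℂ := fun z ↦ H ((z * w) ^ 2) with hG
  have hGd : Differentiable ℂ G := hH.comp (by fun_prop)
  have hGeven : ∀ z, G (-z) = G z := fun z ↦ by simp [hG]
  have hO : G =O[Bornology.cobounded ℂ] fun z ↦ Real.exp (B * ‖w‖ * ‖z‖ ^ (1 : ℝ)) := by
    refine Asymptotics.IsBigO.of_bound A ?_
    have h1 : Tendsto (fun z : ℂ ↦ ‖z‖ * ‖w‖) (Bornology.cobounded ℂ) atTop :=
      tendsto_norm_cobounded_atTop.atTop_mul_const (norm_pos_iff.mpr hw0)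
    filter_upwards [h1.eventually_ge_atTop R] with z hz
    rw [← norm_mul] at hz
    rw [Real.rpow_one, Real.norm_eq_abs, Real.abs_exp, mul_assoc, mul_comm ‖w‖, ← norm_mul]
    rcases le_total 0 (z * w).im with h | h
    · exact hB _ h hz
    · have := hB (-(z * w)) (by rw [Complex.neg_im]; linarith)
        (by rwa [norm_neg])
      rwa [neg_sq, norm_neg] at this
  have hr1 : Tendsto (fun x : ℝ ↦ G x) atTop (𝓝 0) :=
    h0.comp (tendsto_upperDiagonals (w := w) (by simp [hw]) (by simp [hw]))
  have hr2 : Tendsto (fun x : ℝ ↦ G (x * Complex.I)) atTop (𝓝 0) := by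
    simp only [hG, mul_assoc]
    exact h0.comp (tendsto_upperDiagonals (w := Complex.I * w) (by simp [hw]) (by simp [hw]))
  obtain ⟨C₁, hC₁⟩ := exists_norm_le_of_tendsto_atTop
    (hGd.continuous.comp Complex.continuous_ofReal) hr1
  obtain ⟨C₂, hC₂⟩ := exists_norm_le_of_tendsto_atTop
    (g := fun x : ℝ ↦ G (x * Complex.I)) (hGd.continuous.comp (by fun_prop)) hr2
  have hup : ∀ z : ℂ, 0 ≤ z.im → ‖G z‖ ≤ max C₁ C₂ := by
    intro z hz
    have him : ∀ x : ℝ, 0 ≤ x → ‖G (x * Complex.I)‖ ≤ max C₁ C₂ := fun x hx ↦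
      (hC₂ x hx).trans (le_max_right _ _)
    rcases le_total 0 z.re with h | h
    · exact PhragmenLindelof.quadrant_I hGd.diffContOnCl
        ⟨1, by norm_num, _, hO.mono inf_le_left⟩
        (fun x hx ↦ (hC₁ x hx).trans (le_max_left _ _)) him h hz
    · refine PhragmenLindelof.quadrant_II hGd.diffContOnCl
        ⟨1, by norm_num, _, hO.mono inf_le_left⟩ (fun x hx ↦ ?_) him h hz
      have := hC₁ (-x) (by linarith)
      simp only [Function.comp, Complex.ofReal_neg, hGeven] at this
      exact this.trans (le_max_left _ _)
  have hbdd : Bornology.IsBounded (range G) := by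
    refine isBounded_iff_forall_norm_le.mpr ⟨max C₁ C₂, ?_⟩
    rintro _ ⟨z, rfl⟩
    rcases le_total 0 z.im with h | h
    · exact hup z h
    · rw [← hGeven]
      exact hup (-z) (by simpa using h)
  have hG0 : ∀ z, G z = 0 := fun z ↦ by
    refine tendsto_nhds_unique (f := fun x : ℝ ↦ G x) (l := atTop) ?_ hr1
    simp only [fun x : ℝ ↦ hGd.apply_eq_apply_of_bounded hbdd x z]
    exact tendsto_const_nhds
  obtain ⟨s, hs⟩ := IsSquare.exists_sq z (Complex.isSquare z)
  have := hG0 (s / w)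
  simpa only [hG, div_mul_cancel₀ s hw0, ← hs] using this

variable {q₁ q₂ : ℝ → ℝ} {L : ℝ} (F₁ : FundSys q₁ L) (F₂ : FundSys q₂ L) (f₁ f₂ : RatHN)

theorem norm_S_mul_C_le (hq₁ : IntervalIntegrable q₁ volume 0 L)
    (hq₂ : IntervalIntegrable q₂ volume 0 L) {k : ℂ} (hk : 0 ≤ k.im) (hk1 : 1 ≤ ‖k‖)
    (hkq₁ : 2 * ∫ u in (0:ℝ)..L, |q₁ u| ≤ ‖k‖) (hkq₂ : 2 * ∫ u in (0:ℝ)..L, |q₂ u| ≤ ‖k‖)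
    {t : ℝ} (ht : t ∈ Icc 0 L) :
    ‖F₁.S (k ^ 2) t * F₂.C (k ^ 2) t‖ ≤ 4 * Real.exp (2 * t * ‖k‖) := by
  have h1 := F₁.norm_S_le hq₁ hk hkq₁ ht
  have h2 := F₂.norm_C_le hq₂ hk (norm_pos_iff.mp (by linarith)) hkq₂ ht
  have h3 : ‖F₁.S (k ^ 2) t * Complex.exp (Complex.I * k * t)‖ ≤ 2 :=
    (le_mul_of_one_le_left (norm_nonneg _) hk1).trans h1
  have h4 : F₁.S (k ^ 2) t * F₂.C (k ^ 2) t
      = (F₁.S (k ^ 2) t * Complex.exp (Complex.I * k * t))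
        * (F₂.C (k ^ 2) t * Complex.exp (Complex.I * k * t))
        * (Complex.exp (Complex.I * k * t))⁻¹ ^ 2 := by
    have := Complex.exp_ne_zero (Complex.I * k * t)
    field_simp
  rw [h4, norm_mul, norm_mul, norm_pow, norm_inv, IsSol.norm_exp_I_mul, ← Real.exp_neg, neg_neg]
  have h5 : Real.exp (k.im * t) ^ 2 ≤ Real.exp (2 * t * ‖k‖) := by
    rw [← Real.exp_nat_mul]
    refine Real.exp_le_exp.mpr ?_
    have := mul_le_mul_of_nonneg_right ((le_abs_self _).trans (Complex.abs_im_le_norm k)) ht.1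
    push_cast
    linarith
  refine mul_le_mul ?_ h5 (by positivity) (by norm_num)
  calc _ ≤ (2 : ℝ) * 2 := mul_le_mul h3 h2 (norm_nonneg _) (by norm_num)
    _ = 4 := by norm_num

theorem cross_eq (hq₁ : IntervalIntegrable q₁ volume 0 L)
    (hq₂ : IntervalIntegrable q₂ volume 0 L) (h : ∀ lam, F₁.weyl f₁ lam = F₂.weyl f₂ lam)
    {t : ℝ} (ht : t ∈ Icc 0 L) (ht0 : 0 < t) (lam : ℂ) :
    F₁.S lam t * F₂.C lam t = F₂.S lam t * F₁.C lam t := by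
  refine sub_eq_zero.mp (eq_zero_of_tendsto_upperDiagonals
    (H := fun lam ↦ F₁.S lam t * F₂.C lam t - F₂.S lam t * F₁.C lam t)
    (R := max 1 (max (2 * ∫ u in (0:ℝ)..L, |q₁ u|) (2 * ∫ u in (0:ℝ)..L, |q₂ u|))) (A := 8)
    (B := 2 * t) (((F₁.dS t).mul (F₂.dC t)).sub ((F₂.dS t).mul (F₁.dC t))) (fun k hk hR ↦ ?_)
    (tendsto_cross F₁ F₂ f₁ f₂ hq₁ hq₂ h ht ht0) lam)
  simp only [max_le_iff] at hR
  have h1 := norm_S_mul_C_le F₁ F₂ hq₁ hq₂ hk hR.1 hR.2.1 hR.2.2 ht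
  have h2 := norm_S_mul_C_le F₂ F₁ hq₂ hq₁ hk hR.1 hR.2.2 hR.2.1 ht
  refine (norm_sub_le _ _).trans ?_
  linarith

end Vanishing

section Uniqueness

variable {q₁ q₂ : ℝ → ℝ} {L : ℝ}

theorem IsSol.eqOn_Icc {lam : ℂ} {y v z w : ℝ → ℂ} (hL : 0 < L) (h : IsSol q₁ L lam y v)
    (h' : IsSol q₂ L lam z w) (hyz : EqOn y z (Ioo 0 L)) :
    EqOn y z (Icc 0 L) ∧ EqOn v w (Icc 0 L) := by
  have hcl : Icc 0 L ⊆ closure (Ioo 0 L) := (closure_Ioo hL.ne).ge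
  refine ⟨hyz.of_subset_closure h.cont h'.cont Ioo_subset_Icc_self hcl,
    EqOn.of_subset_closure (fun t ht ↦ ?_) h.cont_deriv h'.cont_deriv Ioo_subset_Icc_self hcl⟩
  refine (h.hasDerivAt ht).unique ((h'.hasDerivAt ht).congr_of_eventuallyEq ?_)
  filter_upwards [isOpen_Ioo.mem_nhds ht] with s hs using hyz hs

/-- Two equations sharing a solution that never vanishes on `(0, L)` have the same potential. -/
theorem IsSol.ae_eq {lam : ℂ} {y v z w : ℝ → ℂ} (hL : 0 < L) (h : IsSol q₁ L lam y v)
    (h' : IsSol q₂ L lam z w) (hq₁ : IntervalIntegrable q₁ volume 0 L)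
    (hq₂ : IntervalIntegrable q₂ volume 0 L) (hyz : EqOn y z (Icc 0 L))
    (hvw : EqOn v w (Icc 0 L)) (h0 : ∀ t ∈ Ioo 0 L, y t ≠ 0) :
    ∀ᵐ t : ℝ, t ∈ Ioo 0 L → q₁ t = q₂ t := by
  have i1 := h.intervalIntegrable_coeff hL.le hq₁
  have i2 := h'.intervalIntegrable_coeff hL.le hq₂
  have hsub : ∀ t ∈ Icc 0 L, uIcc 0 t ⊆ uIcc 0 L := fun t ht ↦ by
    rw [uIcc_of_le hL.le, uIcc_of_le ht.1]; exact Icc_subset_Icc le_rfl ht.2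
  have h00 : (0 : ℝ) ∈ Icc 0 L := ⟨le_rfl, hL.le⟩
  filter_upwards [(i1.sub i2).ae_hasDerivAt_integral] with t hder ht
  have ht' := Ioo_subset_Icc_self ht
  have h1 := hder (by rwa [uIcc_of_le hL.le]) 0 (by rwa [uIcc_of_le hL.le])
  have h2 : (fun x : ℝ ↦ ∫ s in (0:ℝ)..x, (((q₁ s : ℂ) - lam) * y s - ((q₂ s : ℂ) - lam) * z s))
      =ᶠ[𝓝 t] fun _ ↦ 0 := by
    filter_upwards [isOpen_Ioo.mem_nhds ht] with x hx
    have hx' := Ioo_subset_Icc_self hx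
    rw [intervalIntegral.integral_sub (i1.mono_set (hsub x hx')) (i2.mono_set (hsub x hx'))]
    have e1 := h.deriv_eq_integral x hx'
    have e2 := h'.deriv_eq_integral x hx'
    rw [hvw hx', hvw h00] at e1
    linear_combination e2 - e1
  have h3 := h1.unique ((hasDerivAt_const t (0 : ℂ)).congr_of_eventuallyEq h2)
  rw [← hyz ht'] at h3
  have h4 : ((q₁ t : ℂ) - q₂ t) * y t = 0 := by linear_combination h3
  have h5 := (mul_eq_zero.mp h4).resolve_right (h0 t ht)
  exact_mod_cast sub_eq_zero.mp h5

variable (F₁ : FundSys q₁ L) (F₂ : FundSys q₂ L) (f₁ f₂ : RatHN)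

theorem eqOn_of_cross_eq (hL : 0 < L) (hq₁ : IntervalIntegrable q₁ volume 0 L)
    (hq₂ : IntervalIntegrable q₂ volume 0 L) {lam : ℂ} (hlam : lam.im ≠ 0)
    (h : ∀ t ∈ Icc 0 L, F₁.S lam t * F₂.C lam t = F₂.S lam t * F₁.C lam t) :
    EqOn (F₁.C lam) (F₂.C lam) (Ioo 0 L) ∧ EqOn (F₁.S lam) (F₂.S lam) (Ioo 0 L) := by
  have hsq : EqOn (F₁.C lam ^ 2) (F₂.C lam ^ 2) (Ioo 0 L) := by
    intro t ht
    have ht' := Ioo_subset_Icc_self ht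
    have hd := ((((F₁.hS lam).hasDerivAt ht).mul ((F₂.hC lam).hasDerivAt ht)).unique
      ((((F₂.hS lam).hasDerivAt ht).mul ((F₁.hC lam).hasDerivAt ht)).congr_of_eventuallyEq (by
        filter_upwards [isOpen_Ioo.mem_nhds ht] with s hs using h s (Ioo_subset_Icc_self hs))))
    have w1 := F₁.wronskian hq₁ lam ht'
    have w2 := F₂.wronskian hq₂ lam ht'
    have hc := h t ht'
    simp only [Pi.pow_apply]
    linear_combination F₂.C lam t ^ 2 * w1 - F₁.C lam t ^ 2 * w2 - F₁.C lam t * F₂.C lam t * hd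
      + (F₂.C lam t * F₁.C' lam t + F₁.C lam t * F₂.C' lam t) * hc
  have hsq' : EqOn (F₁.C lam ^ 2) (F₂.C lam ^ 2) (Ico 0 L) := by
    intro t ht
    rcases ht.1.eq_or_lt with rfl | h0
    · simp [F₁.C_zero, F₂.C_zero]
    · exact hsq ⟨h0, ht.2⟩
  have hne : ∀ {t : ℝ}, t ∈ Ico 0 L → F₂.C lam t ≠ 0 := by
    intro t ht
    rcases ht.1.eq_or_lt with rfl | h0
    · simp [F₂.C_zero]
    · exact F₂.C_ne_zero hq₂ hlam ⟨ht.1, ht.2.le⟩ h0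
  have hC : EqOn (F₁.C lam) (F₂.C lam) (Ico 0 L) := by
    refine (isPreconnected_Ico.eq_or_eq_neg_of_sq_eq ((F₁.hC lam).cont.mono Ico_subset_Icc_self)
      ((F₂.hC lam).cont.mono Ico_subset_Icc_self) hsq' hne).resolve_right fun hneg ↦ ?_
    have := hneg (show (0 : ℝ) ∈ Ico 0 L from ⟨le_rfl, hL⟩)
    rw [Pi.neg_apply, F₁.C_zero, F₂.C_zero] at this
    norm_num at this
  refine ⟨hC.mono Ioo_subset_Ico_self, fun t ht ↦ ?_⟩
  have ht' := Ioo_subset_Ico_self ht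
  have := h t (Ioo_subset_Icc_self ht)
  rw [hC ht'] at this
  exact mul_right_cancel₀ (hne ht') this

theorem eq_of_weyl_eq (hL : 0 < L) (hq₁ : IntervalIntegrable q₁ volume 0 L)
    (hq₂ : IntervalIntegrable q₂ volume 0 L) (h : ∀ lam, F₁.weyl f₁ lam = F₂.weyl f₂ lam) :
    (∀ᵐ t : ℝ, t ∈ Ioo 0 L → q₁ t = q₂ t) ∧ f₁ = f₂ := by
  have hcross : ∀ lam, ∀ t ∈ Icc 0 L, F₁.S lam t * F₂.C lam t = F₂.S lam t * F₁.C lam t := by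
    intro lam t ht
    rcases ht.1.eq_or_lt with rfl | h0
    · simp [F₁.S_zero, F₂.S_zero]
    · exact cross_eq F₁ F₂ f₁ f₂ hq₁ hq₂ h ht h0 lam
  constructor
  · have hI : Complex.I.im ≠ 0 := by simp
    obtain ⟨hC, hC'⟩ := (F₁.hC Complex.I).eqOn_Icc hL (F₂.hC Complex.I)
      (eqOn_of_cross_eq F₁ F₂ hL hq₁ hq₂ hI (hcross _)).1
    exact (F₁.hC Complex.I).ae_eq hL (F₂.hC Complex.I) hq₁ hq₂ hC hC'
      fun t ht ↦ F₁.C_ne_zero hq₁ hI (Ioo_subset_Icc_self ht) ht.1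
  · refine RatHN.ext_of_cEval fun lam hlam ↦ ?_
    obtain ⟨hCo, hSo⟩ := eqOn_of_cross_eq F₁ F₂ hL hq₁ hq₂ hlam (hcross _)
    obtain ⟨hC, hC'⟩ := (F₁.hC lam).eqOn_Icc hL (F₂.hC lam) hCo
    obtain ⟨hS, hS'⟩ := (F₁.hS lam).eqOn_Icc hL (F₂.hS lam) hSo
    have hLm : L ∈ Icc 0 L := ⟨hL.le, le_rfl⟩
    have e : F₁.weylSol f₁ lam L = F₂.weylSol f₂ lam L := by
      simp only [FundSys.weylSol, hC hLm, hS hLm, h]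
    have e' : F₁.weylSol' f₁ lam L = F₂.weylSol' f₂ lam L := by
      simp only [FundSys.weylSol', hC' hLm, hS' hLm, h]
    rw [F₁.weylSol'_end f₁ hq₁ hL hlam, F₂.weylSol'_end f₂ hq₂ hL hlam, e] at e'
    refine mul_right_cancel₀ ?_ e'
    rw [F₂.weylSol_end f₂ hq₂ hL hlam]
    exact div_ne_zero (f₂.denom_ne_zero hlam) (F₂.charS_ne_zero f₂ hq₂ hL hlam)

end Uniqueness

theorem two_spectra_uniqueness
    (q₁ q₂ : ℝ → ℝ)
    (hq₁ : IntegrableOn q₁ (Ioo 0 Real.pi))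
    (hq₂ : IntegrableOn q₂ (Ioo 0 Real.pi))
    (f₁ f₂ : RatHN)
    (hinf : eigenvalues q₁ f₁ none = eigenvalues q₂ f₂ none)
    (hzero : eigenvalues q₁ f₁ (some 0) = eigenvalues q₂ f₂ (some 0)) :
    (∀ᵐ x : ℝ ∂volume, x ∈ Ioo 0 Real.pi → q₁ x = q₂ x) ∧ f₁ = f₂ := by
  have i₁ : IntervalIntegrable q₁ volume 0 Real.pi :=
    (intervalIntegrable_iff_integrableOn_Ioo_of_le Real.pi_pos.le).mpr hq₁
  have i₂ : IntervalIntegrable q₂ volume 0 Real.pi :=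
    (intervalIntegrable_iff_integrableOn_Ioo_of_le Real.pi_pos.le).mpr hq₂
  obtain ⟨F₁⟩ := nonempty_fundSys Real.pi_pos.le i₁.reflect
  obtain ⟨F₂⟩ := nonempty_fundSys Real.pi_pos.le i₂.reflect
  obtain ⟨c, hc⟩ := exists_weyl_eq_const_mul Real.pi_pos i₁.reflect i₂.reflect F₁ F₂ f₁ f₂
    (fun x ↦ by
      rw [← isEigen_none_iff F₁ f₁ i₁, ← isEigen_none_iff F₂ f₂ i₂]
      exact Set.ext_iff.mp hinf x)
    (fun x ↦ by
      rw [← isEigen_zero_iff F₁ f₁ i₁, ← isEigen_zero_iff F₂ f₂ i₂]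
      exact Set.ext_iff.mp hzero x)
  obtain ⟨hq, hf⟩ := eq_of_weyl_eq F₁ F₂ f₁ f₂ Real.pi_pos i₁.reflect i₂.reflect
    (weyl_eq_of_eq_const_mul F₁ F₂ f₁ f₂ Real.pi_pos i₁.reflect i₂.reflect hc)
  refine ⟨?_, hf⟩
  filter_upwards [(volume.measurePreserving_sub_left Real.pi).quasiMeasurePreserving.ae hq]
    with x hx hxm
  simpa using hx ⟨by linarith [hxm.2], by linarith [hxm.1]⟩
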